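/- arXiv:0708.0296 — 6 statements merged into one kernel-verified Lean document; each statement's English description precedes it below -/
import Mathlib

section
/- For every integer n and every compact set K contained in the upper half-plane ℍ with i ∉ K, there exists a constant C > 0 such that for all real r ≥ 1 and all z ∈ K, the generalized spherical function satisfies |Φ_{r,n}(z)| ≤ C / √r. -/
open MeasureTheory Complex

noncomputable section

/-- Möbius action of a real 2×2 matrix on a complex number. -/
def moebius (g : Matrix (Fin 2) (Fin 2) ℝ) (z : ℂ) : ℂ :=
  ((g 0 0 : ℂ) * z + (g 0 1 : ℂ)) / ((g 1 0 : ℂ) * z + (g 1 1 : ℂ))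

/-- The rotation matrix `k_θ ∈ SL(2,ℝ)`. -/
def kMat (θ : ℝ) : Matrix (Fin 2) (Fin 2) ℝ :=
  !![Real.cos θ, Real.sin θ; -Real.sin θ, Real.cos θ]

/-- The function `φ_r(z) = (Im z)^{ir + 1/2}`. -/
def phir (r : ℝ) (z : ℂ) : ℂ :=
  Complex.exp ((r * Complex.I + 1 / 2) * Complex.log (z.im))

/-- The generalized spherical function
`Φ_{r,n}(z) = (1/π) ∫_0^π φ_r(k_θ⁻¹ · z) e^{2inθ} dθ` (note `k_θ⁻¹ = k_{-θ}`). -/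
def sphFn (r : ℝ) (n : ℤ) (z : ℂ) : ℂ :=
  (1 / Real.pi : ℂ) * ∫ θ in (0 : ℝ)..Real.pi,
    phir r (moebius (kMat (-θ)) z) * Complex.exp (2 * n * θ * Complex.I)

/-- The average of `1 / ((b sin u)² + δ)` over a period is `O(δ^{-1/2})`. -/
lemma integral_inv_sin_sq_le {b δ : ℝ} (hb : 0 < b) (hδ : 0 < δ) :
    ∫ u in (-(Real.pi / 2))..(Real.pi / 2), ((b * Real.sin u) ^ 2 + δ)⁻¹
      ≤ Real.pi ^ 2 / (2 * b * Real.sqrt δ) := by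
  have hpi := Real.pi_pos
  have hsδ : 0 < Real.sqrt δ := Real.sqrt_pos.2 hδ
  set c : ℝ := 2 * b / Real.pi with hc
  have hc0 : 0 < c := by positivity
  have hderiv : ∀ u : ℝ, HasDerivAt
      (fun u => Real.arctan (c * u / Real.sqrt δ) / (c * Real.sqrt δ))
      ((c * u) ^ 2 + δ)⁻¹ u := by
    intro u
    have h := ((((hasDerivAt_id u).const_mul c).div_const (Real.sqrt δ)).arctan).div_const
      (c * Real.sqrt δ)
    refine h.congr_deriv ?_
    have hsq : Real.sqrt δ ^ 2 = δ := Real.sq_sqrt hδ.le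
    have h1 : (c * u) ^ 2 + δ ≠ 0 := by positivity
    have h2 : 1 + (c * u / Real.sqrt δ) ^ 2 = ((c * u) ^ 2 + δ) / δ := by
      rw [div_pow, hsq]; field_simp; ring
    rw [id, h2]
    field_simp
    rw [hsq]
  have hcont : Continuous fun u : ℝ => ((c * u) ^ 2 + δ)⁻¹ :=
    Continuous.inv₀ (by fun_prop) fun u => by positivity
  have hcont' : Continuous fun u : ℝ => ((b * Real.sin u) ^ 2 + δ)⁻¹ :=
    Continuous.inv₀ (by fun_prop) fun u => by positivity
  calc ∫ u in (-(Real.pi / 2))..(Real.pi / 2), ((b * Real.sin u) ^ 2 + δ)⁻¹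
      ≤ ∫ u in (-(Real.pi / 2))..(Real.pi / 2), ((c * u) ^ 2 + δ)⁻¹ := by
        refine intervalIntegral.integral_mono_on (by linarith)
          (hcont'.intervalIntegrable _ _) (hcont.intervalIntegrable _ _) fun u hu => ?_
        have habs : |u| ≤ Real.pi / 2 := abs_le.2 hu
        have hle := Real.mul_abs_le_abs_sin habs
        have : (c * u) ^ 2 ≤ (b * Real.sin u) ^ 2 := by
          rw [sq_le_sq, abs_mul, abs_mul, abs_of_pos hc0, abs_of_pos hb, hc]
          calc 2 * b / Real.pi * |u| = b * (2 / Real.pi * |u|) := by ring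
            _ ≤ b * |Real.sin u| := by gcongr
        gcongr
    _ = Real.arctan (c * (Real.pi / 2) / Real.sqrt δ) / (c * Real.sqrt δ)
        - Real.arctan (c * (-(Real.pi / 2)) / Real.sqrt δ) / (c * Real.sqrt δ) :=
        intervalIntegral.integral_eq_sub_of_hasDerivAt (fun u _ => hderiv u)
          (hcont.intervalIntegrable _ _)
    _ ≤ Real.pi / (c * Real.sqrt δ) := by
        rw [← sub_div]
        have := Real.arctan_lt_pi_div_two (c * (Real.pi / 2) / Real.sqrt δ)
        have := Real.neg_pi_div_two_lt_arctan (c * (-(Real.pi / 2)) / Real.sqrt δ)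
        gcongr
        linarith
    _ = Real.pi ^ 2 / (2 * b * Real.sqrt δ) := by
        rw [hc]; field_simp

lemma integral_inv_sin_two_mul_sub_sq_le {b δ : ℝ} (hb : 0 < b) (hδ : 0 < δ) (α : ℝ) :
    ∫ θ in (0 : ℝ)..Real.pi, ((b * Real.sin (2 * θ - α)) ^ 2 + δ)⁻¹
      ≤ Real.pi ^ 2 / (2 * b * Real.sqrt δ) := by
  set f : ℝ → ℝ := fun u => ((b * Real.sin u) ^ 2 + δ)⁻¹ with hf
  have hper : Function.Periodic f Real.pi := fun u => by
    simp only [hf, Real.sin_add_pi, mul_neg, neg_sq]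
  have hcont : Continuous f := Continuous.inv₀ (by fun_prop) fun u => by positivity
  have hshift (a : ℝ) : ∫ u in a..a + Real.pi, f u
      = ∫ u in (-(Real.pi / 2))..(Real.pi / 2), f u := by
    rw [hper.intervalIntegral_add_eq a (-(Real.pi / 2))]
    congr 1
    ring
  have hsub : ∫ θ in (0 : ℝ)..Real.pi, f (2 * θ - α)
      = ∫ u in (-(Real.pi / 2))..(Real.pi / 2), f u := by
    rw [intervalIntegral.integral_comp_mul_sub f two_ne_zero α,
      ← intervalIntegral.integral_add_adjacent_intervals
        (hcont.intervalIntegrable _ (2 * 0 - α + Real.pi)) (hcont.intervalIntegrable _ _),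
      show 2 * Real.pi - α = (2 * 0 - α + Real.pi) + Real.pi by ring, hshift, hshift]
    simp only [smul_eq_mul]
    ring
  exact hsub.trans_le (integral_inv_sin_sq_le hb hδ)

/-- Integration by parts for an oscillatory integral whose phase `log (y / D)` has derivative
`-S / D`, with the regularised multiplier `S² / (S² + δ)` removing the stationary points. -/
lemma norm_integral_exp_log_mul_exp_le {D S T : ℝ → ℝ} {y δ M N : ℝ} {s : ℂ} (n : ℤ)
    (hD : ∀ θ, HasDerivAt D (S θ) θ) (hS : ∀ θ, HasDerivAt S (T θ) θ) (hT : Continuous T)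
    (hD0 : ∀ θ, 0 < D θ) (hy : 0 < y) (hδ : 0 < δ) (hs : s ≠ 0)
    (hDπ : D Real.pi = D 0) (hSπ : S Real.pi = S 0)
    (hM : ∀ θ, ‖Complex.exp (s * (Real.log (y / D θ) : ℂ))‖ ≤ M)
    (hN : ∀ θ, S θ ^ 2 + D θ * |T θ| + 2 * |(n : ℝ)| * (D θ * |S θ|) ≤ N) :
    ‖∫ θ in (0 : ℝ)..Real.pi, Complex.exp (s * (Real.log (y / D θ) : ℂ)) *
        Complex.exp (2 * n * θ * Complex.I)‖
      ≤ M * (δ + N / ‖s‖) * ∫ θ in (0 : ℝ)..Real.pi, (S θ ^ 2 + δ)⁻¹ := by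
  have hDc : Continuous D := continuous_iff_continuousAt.2 fun θ => (hD θ).continuousAt
  have hSc : Continuous S := continuous_iff_continuousAt.2 fun θ => (hS θ).continuousAt
  have hq : ∀ θ, 0 < S θ ^ 2 + δ := fun θ => by positivity
  have hlog : Continuous fun θ => Real.log (y / D θ) :=
    Continuous.log (continuous_const.div hDc fun θ => (hD0 θ).ne')
      fun θ => (div_pos hy (hD0 θ)).ne'
  set F : ℝ → ℂ := fun θ => Complex.exp (s * (Real.log (y / D θ) : ℂ)) with hF
  set e : ℝ → ℂ := fun θ => Complex.exp (2 * n * θ * Complex.I) with he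
  set R : ℝ → ℝ := fun θ => D θ * S θ / (S θ ^ 2 + δ) with hR
  set R' : ℝ → ℝ := fun θ => ((S θ * S θ + D θ * T θ) * (S θ ^ 2 + δ)
    - D θ * S θ * (2 * S θ * T θ)) / (S θ ^ 2 + δ) ^ 2 with hR'
  have hFc : Continuous F := by fun_prop
  have hec : Continuous e := by fun_prop
  have hRc : Continuous R := by
    refine Continuous.div (by fun_prop) (by fun_prop) fun θ => (hq θ).ne'
  have hRc' : Continuous R' := by
    refine Continuous.div (by fun_prop) (by fun_prop) fun θ => (pow_pos (hq θ) 2).ne'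
  have hFd : ∀ θ, HasDerivAt F (F θ * (s * ((-(S θ / D θ) : ℝ) : ℂ))) θ := by
    intro θ
    have h1 : HasDerivAt (fun θ => Real.log (y / D θ)) (-(S θ / D θ)) θ := by
      have hne := (hD0 θ).ne'
      have h := ((hasDerivAt_const θ y).div (hD θ) hne).log (div_pos hy (hD0 θ)).ne'
      refine h.congr_deriv ?_
      simp only [Pi.div_apply]
      field_simp
      ring
    exact (h1.ofReal_comp.const_mul s).cexp
  have hed : ∀ θ, HasDerivAt e (e θ * (2 * n * Complex.I)) θ := by
    intro θ
    have h := (((hasDerivAt_id θ).ofReal_comp.const_mul (2 * n : ℂ)).mul_const Complex.I).cexp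
    simpa using h
  have hRd : ∀ θ, HasDerivAt R (R' θ) θ := by
    intro θ
    have h := ((hD θ).mul (hS θ)).div (((hS θ).pow 2).add_const δ) (hq θ).ne'
    refine h.congr_deriv ?_
    simp only [hR', Pi.mul_apply, Pi.pow_apply]
    ring
  set G' : ℝ → ℂ := fun θ => F θ * (s * ((-(S θ / D θ) : ℝ) : ℂ)) * ((R θ : ℂ) * e θ)
    + F θ * ((R' θ : ℂ) * e θ + (R θ : ℂ) * (e θ * (2 * n * Complex.I))) with hG'
  have hGd : ∀ θ, HasDerivAt (fun θ => F θ * ((R θ : ℂ) * e θ)) (G' θ) θ := fun θ =>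
    (hFd θ).mul ((hRd θ).ofReal_comp.mul (hed θ))
  have hSD : Continuous fun θ => S θ / D θ := hSc.div hDc fun θ => (hD0 θ).ne'
  have hGc : Continuous G' := by fun_prop
  have heπ : e Real.pi = e 0 := by
    simp only [he, Complex.ofReal_zero, mul_zero, zero_mul, Complex.exp_zero]
    rw [show (2 * n * Real.pi * Complex.I : ℂ) = n * (2 * Real.pi * Complex.I) by ring]
    exact Complex.exp_int_mul_two_pi_mul_I n
  have hG0 : ∫ θ in (0 : ℝ)..Real.pi, G' θ = 0 := by
    rw [intervalIntegral.integral_eq_sub_of_hasDerivAt (fun θ _ => hGd θ)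
      (hGc.intervalIntegrable _ _)]
    simp only [hF, hR, hDπ, hSπ, heπ, sub_self]
  have hkey : ∫ θ in (0 : ℝ)..Real.pi, F θ * e θ
      = ∫ θ in (0 : ℝ)..Real.pi, (F θ * e θ + G' θ / s) := by
    have hFe : Continuous fun θ => F θ * e θ := hFc.mul hec
    rw [intervalIntegral.integral_add (hFe.intervalIntegrable _ _)
      ((hGc.div_const s).intervalIntegrable _ _), intervalIntegral.integral_div, hG0]
    simp
  have hqc : Continuous fun θ => (S θ ^ 2 + δ)⁻¹ :=
    Continuous.inv₀ (by fun_prop) fun θ => (hq θ).ne'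
  rw [hkey, ← intervalIntegral.integral_const_mul]
  refine intervalIntegral.norm_integral_le_of_norm_le Real.pi_pos.le
    (Filter.Eventually.of_forall fun θ _ => ?_)
    ((hqc.const_mul _).intervalIntegrable _ _)
  have hq' := hq θ
  have hD' := hD0 θ
  have hen : ‖e θ‖ = 1 := by
    have := Complex.norm_exp_ofReal_mul_I (2 * n * θ)
    push_cast at this
    exact this
  have hRn : |R θ| = D θ * |S θ| / (S θ ^ 2 + δ) := by
    simp only [hR, abs_div, abs_mul, abs_of_pos hD', abs_of_pos hq']
  have hRn' : |R' θ| ≤ (S θ ^ 2 + D θ * |T θ|) / (S θ ^ 2 + δ) := by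
    have heq : R' θ = (S θ ^ 2 + D θ * (T θ * ((δ - S θ ^ 2) / (S θ ^ 2 + δ))))
        / (S θ ^ 2 + δ) := by
      simp only [hR']
      field_simp
      ring
    rw [heq, abs_div, abs_of_pos hq']
    gcongr
    refine (abs_add_le _ _).trans ?_
    rw [abs_of_nonneg (sq_nonneg (S θ)), abs_mul, abs_of_pos hD', abs_mul]
    have : |(δ - S θ ^ 2) / (S θ ^ 2 + δ)| ≤ 1 := by
      rw [abs_div, abs_of_pos hq', div_le_one hq', abs_le]
      constructor <;> nlinarith [sq_nonneg (S θ)]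
    have h2 := mul_le_of_le_one_right (abs_nonneg (T θ)) this
    gcongr
  have hid : F θ * e θ + G' θ / s = F θ * (e θ * (((δ / (S θ ^ 2 + δ) : ℝ) : ℂ)
      + ((R' θ : ℂ) + (R θ : ℂ) * (2 * n * Complex.I)) / s)) := by
    have h1 : (D θ : ℂ) ≠ 0 := by exact_mod_cast hD'.ne'
    have h2 : ((S θ : ℂ) ^ 2 + δ) ≠ 0 := by exact_mod_cast hq'.ne'
    simp only [hG', hR]
    push_cast
    field_simp
    ring
  have hsn : 0 < ‖s‖ := norm_pos_iff.2 hs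
  have hM0 : 0 ≤ M := (norm_nonneg _).trans (hM θ)
  rw [hid, norm_mul, norm_mul, hen, one_mul, mul_assoc M]
  refine mul_le_mul (hM θ) ?_ (norm_nonneg _) hM0
  calc _ ≤ δ / (S θ ^ 2 + δ) + (|R' θ| + |R θ| * (2 * |(n : ℝ)|)) / ‖s‖ := by
        refine (norm_add_le _ _).trans ?_
        rw [norm_div, Complex.norm_real, Real.norm_of_nonneg (by positivity)]
        gcongr
        refine (norm_add_le _ _).trans ?_
        simp
    _ ≤ δ / (S θ ^ 2 + δ) + ((S θ ^ 2 + D θ * |T θ|) / (S θ ^ 2 + δ)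
        + D θ * |S θ| / (S θ ^ 2 + δ) * (2 * |(n : ℝ)|)) / ‖s‖ := by
        rw [hRn]; gcongr
    _ = (δ + (S θ ^ 2 + D θ * |T θ| + 2 * |(n : ℝ)| * (D θ * |S θ|)) / ‖s‖)
        * (S θ ^ 2 + δ)⁻¹ := by
        field_simp
    _ ≤ (δ + N / ‖s‖) * (S θ ^ 2 + δ)⁻¹ := by gcongr; exact hN θ

/-- The mean `A` in `|z sin θ + cos θ|² = A + B cos (2θ - α)`. -/
def phaseMean (z : ℂ) : ℝ := (1 + Complex.normSq z) / 2

/-- The vector `B e^{iα}` in `|z sin θ + cos θ|² = A + B cos (2θ - α)`. -/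
def phaseVec (z : ℂ) : ℂ := ⟨(1 - Complex.normSq z) / 2, z.re⟩

lemma norm_phaseVec_sq (z : ℂ) : ‖phaseVec z‖ ^ 2 = phaseMean z ^ 2 - z.im ^ 2 := by
  rw [← Complex.normSq_eq_norm_sq, Complex.normSq_apply, phaseVec, phaseMean,
    Complex.normSq_apply]
  ring

lemma norm_phaseVec_pos {z : ℂ} (hz : 0 < z.im) (hzi : z ≠ Complex.I) : 0 < ‖phaseVec z‖ := by
  refine norm_pos_iff.2 fun h => hzi ?_
  have hre : z.re = 0 := congrArg Complex.im h
  have him : (1 - Complex.normSq z) / 2 = 0 := congrArg Complex.re h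
  rw [Complex.normSq_apply, hre] at him
  refine Complex.ext (by simpa using hre) ?_
  rw [Complex.I_im]
  nlinarith

lemma continuous_phaseMean : Continuous phaseMean := by
  unfold phaseMean
  fun_prop

lemma continuous_phaseVec : Continuous phaseVec := by
  have h : phaseVec = fun z => (((1 - Complex.normSq z) / 2 : ℝ) : ℂ) + z.re * Complex.I := by
    funext z
    apply Complex.ext <;> simp [phaseVec]
  rw [h]
  fun_prop

lemma moebius_kMat_neg_im (z : ℂ) (θ : ℝ) :
    (moebius (kMat (-θ)) z).im = z.im /
      (phaseMean z + ‖phaseVec z‖ * Real.cos (2 * θ - Complex.arg (phaseVec z))) := by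
  have h1 : ‖phaseVec z‖ * Real.cos (Complex.arg (phaseVec z)) = (1 - Complex.normSq z) / 2 :=
    Complex.norm_mul_cos_arg _
  have h2 : ‖phaseVec z‖ * Real.sin (Complex.arg (phaseVec z)) = z.re :=
    Complex.norm_mul_sin_arg _
  have hcs := Real.sin_sq_add_cos_sq θ
  have hden : Complex.normSq (Real.sin θ * z + Real.cos θ) =
      phaseMean z + ‖phaseVec z‖ * Real.cos (2 * θ - Complex.arg (phaseVec z)) := by
    rw [Real.cos_sub, mul_add, mul_left_comm, h1, mul_left_comm, h2, Real.cos_two_mul,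
      Real.sin_two_mul, phaseMean, Complex.normSq_apply, Complex.normSq_apply]
    simp only [Complex.add_re, Complex.add_im, Complex.re_ofReal_mul, Complex.im_ofReal_mul,
      Complex.ofReal_re, Complex.ofReal_im]
    linear_combination (z.re * z.re + z.im * z.im) * hcs
  have hm : moebius (kMat (-θ)) z
      = (Real.cos θ * z - Real.sin θ) / (Real.sin θ * z + Real.cos θ) := by
    simp [moebius, kMat, sub_eq_add_neg]
  rw [hm, Complex.div_im, hden, ← sub_div]
  congr 1
  simp only [Complex.add_re, Complex.add_im, Complex.sub_re, Complex.sub_im,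
    Complex.re_ofReal_mul, Complex.im_ofReal_mul, Complex.ofReal_re, Complex.ofReal_im]
  linear_combination z.im * hcs

/-- An explicit admissible constant in the decay estimate at the point `z`. -/
def decayConst (n : ℤ) (z : ℂ) : ℝ :=
  Real.sqrt ((phaseMean z + ‖phaseVec z‖) / z.im) *
    (1 + (4 * ‖phaseVec z‖ ^ 2 + (phaseMean z + ‖phaseVec z‖) * (4 * ‖phaseVec z‖)
      + 2 * |(n : ℝ)| * ((phaseMean z + ‖phaseVec z‖) * (2 * ‖phaseVec z‖)))) *
    (Real.pi ^ 2 / (4 * ‖phaseVec z‖))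

lemma norm_sphFn_le (n : ℤ) {r : ℝ} (hr : 0 < r) {z : ℂ} (hz : 0 < z.im)
    (hzi : z ≠ Complex.I) : ‖sphFn r n z‖ ≤ decayConst n z / Real.sqrt r := by
  have hB := norm_phaseVec_pos hz hzi
  have hsq := norm_phaseVec_sq z
  have hA : 0 < phaseMean z := by
    have := Complex.normSq_nonneg z
    unfold phaseMean
    positivity
  have hmoeb := moebius_kMat_neg_im z
  unfold decayConst
  set A := phaseMean z
  set B := ‖phaseVec z‖
  set α := Complex.arg (phaseVec z)
  have hAB : 0 < A - B := by
    have : 0 < (A - B) * (A + B) := by nlinarith [pow_pos hz 2]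
    exact pos_of_mul_pos_left this (by positivity)
  set D : ℝ → ℝ := fun θ => A + B * Real.cos (2 * θ - α) with hD
  set S : ℝ → ℝ := fun θ => -(2 * B * Real.sin (2 * θ - α)) with hS
  set T : ℝ → ℝ := fun θ => -(4 * B * Real.cos (2 * θ - α)) with hT
  have hlin : ∀ θ : ℝ, HasDerivAt (fun θ => 2 * θ - α) 2 θ := fun θ => by
    simpa using ((hasDerivAt_id θ).const_mul 2).sub_const α
  have hDd : ∀ θ, HasDerivAt D (S θ) θ := fun θ => by
    refine ((((hlin θ).cos).const_mul B).const_add A).congr_deriv ?_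
    simp only [hS]
    ring
  have hSd : ∀ θ, HasDerivAt S (T θ) θ := fun θ => by
    refine (((hlin θ).sin).const_mul (2 * B)).neg.congr_deriv ?_
    simp only [hT]
    ring
  have hDlow : ∀ θ, A - B ≤ D θ := fun θ => by
    simp only [hD]
    nlinarith [Real.neg_one_le_cos (2 * θ - α)]
  have hDup : ∀ θ, D θ ≤ A + B := fun θ => by
    simp only [hD]
    nlinarith [Real.cos_le_one (2 * θ - α)]
  have hD0 : ∀ θ, 0 < D θ := fun θ => hAB.trans_le (hDlow θ)
  have hSup : ∀ θ, |S θ| ≤ 2 * B := fun θ => by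
    simp only [hS, abs_neg, abs_mul, abs_two, abs_of_pos hB]
    exact mul_le_of_le_one_right (by positivity) (Real.abs_sin_le_one _)
  have hTup : ∀ θ, |T θ| ≤ 4 * B := fun θ => by
    rw [hT, abs_neg, abs_mul, abs_of_pos (by positivity : 0 < 4 * B)]
    exact mul_le_of_le_one_right (by positivity) (Real.abs_cos_le_one _)
  set s : ℂ := r * Complex.I + 1 / 2 with hs
  have hsre : s.re = 1 / 2 := by simp [hs]
  have hsim : s.im = r := by simp [hs]
  have hsr : r ≤ ‖s‖ := by
    have := Complex.abs_im_le_norm s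
    rwa [hsim, abs_of_pos hr] at this
  have hs0 : s ≠ 0 := norm_pos_iff.1 (hr.trans_le hsr)
  have hM : ∀ θ, ‖Complex.exp (s * (Real.log (z.im / D θ) : ℂ))‖
      ≤ Real.sqrt ((A + B) / z.im) := fun θ => by
    have hpos : 0 < z.im / D θ := div_pos hz (hD0 θ)
    rw [Complex.norm_exp, Complex.re_mul_ofReal, hsre, Real.sqrt_eq_rpow,
      mul_comm, ← Real.rpow_def_of_pos hpos]
    refine Real.rpow_le_rpow hpos.le ?_ (by norm_num)
    rw [div_le_div_iff₀ (hD0 θ) hz]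
    nlinarith [mul_le_mul_of_nonneg_left (hDlow θ) (by positivity : 0 ≤ A + B)]
  set N : ℝ := 4 * B ^ 2 + (A + B) * (4 * B) + 2 * |(n : ℝ)| * ((A + B) * (2 * B)) with hNdef
  have hN : ∀ θ, S θ ^ 2 + D θ * |T θ| + 2 * |(n : ℝ)| * (D θ * |S θ|) ≤ N := fun θ => by
    have h1 : S θ ^ 2 ≤ 4 * B ^ 2 := by
      rw [← sq_abs]
      nlinarith [hSup θ, abs_nonneg (S θ)]
    rw [hNdef]
    gcongr
    exacts [hDup θ, hTup θ, hDup θ, hSup θ]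
  have hper : 2 * Real.pi - α = 2 * 0 - α + 2 * Real.pi := by ring
  have hmain := norm_integral_exp_log_mul_exp_le (δ := r⁻¹) (s := s) n hDd hSd (by fun_prop)
    hD0 hz (inv_pos.2 hr) hs0 (by simp only [hD, hper, Real.cos_add_two_pi])
    (by simp only [hS, hper, Real.sin_add_two_pi]) hM hN
  have hqint : ∫ θ in (0 : ℝ)..Real.pi, (S θ ^ 2 + r⁻¹)⁻¹
      ≤ Real.pi ^ 2 / (4 * B) * Real.sqrt r := by
    have h := integral_inv_sin_two_mul_sub_sq_le (b := 2 * B) (by positivity) (inv_pos.2 hr) α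
    simp only [hS, neg_sq]
    refine h.trans_eq ?_
    rw [Real.sqrt_inv]
    field_simp
    ring
  have hN0 : 0 ≤ N := by positivity
  have hsph : sphFn r n z = (1 / Real.pi : ℂ) * ∫ θ in (0 : ℝ)..Real.pi,
      Complex.exp (s * (Real.log (z.im / D θ) : ℂ)) * Complex.exp (2 * n * θ * Complex.I) := by
    unfold sphFn phir
    congr 2
    funext θ
    rw [hmoeb θ, Complex.ofReal_log (div_pos hz (hD0 θ)).le]
  have hpi : ‖(1 / Real.pi : ℂ)‖ ≤ 1 := by
    rw [norm_div, norm_one, Complex.norm_real, Real.norm_of_nonneg Real.pi_pos.le]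
    exact div_le_one_of_le₀ (by linarith [Real.pi_gt_three]) Real.pi_pos.le
  rw [hsph, norm_mul]
  calc _ ≤ 1 * (Real.sqrt ((A + B) / z.im) * (r⁻¹ + N / ‖s‖)
          * ∫ θ in (0 : ℝ)..Real.pi, (S θ ^ 2 + r⁻¹)⁻¹) :=
        mul_le_mul hpi hmain (norm_nonneg _) zero_le_one
    _ ≤ 1 * (Real.sqrt ((A + B) / z.im) * (r⁻¹ + N / r)
          * (Real.pi ^ 2 / (4 * B) * Real.sqrt r)) := by
        have : 0 ≤ ∫ θ in (0 : ℝ)..Real.pi, (S θ ^ 2 + r⁻¹)⁻¹ :=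
          intervalIntegral.integral_nonneg Real.pi_pos.le fun θ _ => by positivity
        gcongr
    _ = Real.sqrt ((A + B) / z.im) * (1 + N) * (Real.pi ^ 2 / (4 * B))
          * (Real.sqrt r / r) := by ring
    _ = _ := by rw [Real.sqrt_div_self, div_eq_mul_inv _ (Real.sqrt r)]

/-- For every integer `n` and every compact set `K ⊆ ℍ` with `i ∉ K`, there is `C > 0`
such that for all `r ≥ 1` and all `z ∈ K`, `|Φ_{r,n}(z)| ≤ C / √r`. -/
theorem spherical_function_decay (n : ℤ) (K : Set ℂ) (hK : IsCompact K)
    (hKH : K ⊆ {z : ℂ | 0 < z.im}) (hiK : Complex.I ∉ K) :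
    ∃ C > 0, ∀ r : ℝ, 1 ≤ r → ∀ z ∈ K, ‖sphFn r n z‖ ≤ C / Real.sqrt r := by
  have hcont : ContinuousOn (decayConst n) K := by
    have hA := continuous_phaseMean.continuousOn (s := K)
    have hB := continuous_phaseVec.norm.continuousOn (s := K)
    have him := Complex.continuous_im.continuousOn (s := K)
    have him0 : ∀ z ∈ K, z.im ≠ 0 := fun z hz => (hKH hz).ne'
    have hB0 : ∀ z ∈ K, 4 * ‖phaseVec z‖ ≠ 0 := fun z hz =>
      (mul_pos four_pos (norm_phaseVec_pos (hKH hz) fun h => hiK (h ▸ hz))).ne'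
    have h1 := ((hA.add hB).div him him0).sqrt
    have h2 := (continuousOn_const (c := Real.pi ^ 2)).div (hB.const_mul 4) hB0
    exact (h1.mul (by fun_prop)).mul h2
  obtain ⟨C, hC⟩ := hK.exists_bound_of_continuousOn hcont
  refine ⟨max C 1, by positivity, fun r hr z hz => ?_⟩
  refine (norm_sphFn_le n (by linarith) (hKH hz) fun h => hiK (h ▸ hz)).trans ?_
  gcongr
  exact (le_abs_self _).trans ((hC z hz).trans (le_max_left _ _))

end
end

section
/- Fix y > 0 with y ≠ 1 and define ψ_y(θ) = (1/2)·log( y / (sin²θ·(y²−1) + 1) ) for θ ∈ ℝ. Then: (a) for all θ ∈ ℝ, Im(k_θ·(iy)) = y/(sin²θ·(y²−1)+1), so that φ_r(k_θ·(iy)) = exp((2ir+1)·ψ_y(θ)); (b) ψ_y′(θ) = 0 if and only if θ = πl/2 for some integer l; (c) at these critical points, ψ_y″(πl) = 1 − y² for l ∈ ℤ and ψ_y″(π/2 + πl) = 1 − y^{−2} for l ∈ ℤ, and in particular the second derivative is nonzero at every critical point. -/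
open Complex

noncomputable section

/-- The phase function `ψ_y(θ) = (1/2)·log( y / (sin²θ·(y²−1) + 1) )`. -/
def psiPhase (y : ℝ) (θ : ℝ) : ℝ :=
  (1 / 2) * Real.log (y / (Real.sin θ ^ 2 * (y ^ 2 - 1) + 1))

theorem psiPhase_denom_pos (y : ℝ) (hy : 0 < y) (θ : ℝ) :
    0 < Real.sin θ ^ 2 * (y ^ 2 - 1) + 1 := by
  have h := Real.sin_sq_add_cos_sq θ
  rcases eq_or_ne (Real.sin θ) 0 with hs | hs
  · simp [hs]
  · have h1 : 0 < Real.sin θ ^ 2 * y ^ 2 := by positivity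
    nlinarith [sq_nonneg (Real.cos θ)]

theorem im_moebius_kMat (y : ℝ) (θ : ℝ) :
    (moebius (kMat θ) (Complex.I * y)).im = y / (Real.sin θ ^ 2 * (y ^ 2 - 1) + 1) := by
  have h := Real.sin_sq_add_cos_sq θ
  have hD : Real.sin θ ^ 2 * (y ^ 2 - 1) + 1
      = Real.cos θ * Real.cos θ + Real.sin θ * y * (Real.sin θ * y) := by
    linear_combination -h
  have hN : y = y * (Real.cos θ * Real.cos θ + Real.sin θ * Real.sin θ) := by
    linear_combination -y * h
  rw [hD]
  nth_rewrite 2 [hN]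
  simp [moebius, kMat, Complex.div_im, Complex.normSq_apply, -Complex.ofReal_cos,
    -Complex.ofReal_sin]
  ring

theorem hasDerivAt_psiPhase_denom (y θ : ℝ) :
    HasDerivAt (fun t : ℝ => Real.sin t ^ 2 * (y ^ 2 - 1) + 1)
      (2 * Real.sin θ * Real.cos θ * (y ^ 2 - 1)) θ := by
  have h := (((Real.hasDerivAt_sin θ).pow 2).mul_const (y ^ 2 - 1)).add_const 1
  exact h.congr_deriv (by simp)

theorem hasDerivAt_psiPhase (y : ℝ) (hy : 0 < y) (θ : ℝ) :
    HasDerivAt (psiPhase y)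
      (-(y ^ 2 - 1) * (Real.sin θ * Real.cos θ) / (Real.sin θ ^ 2 * (y ^ 2 - 1) + 1)) θ := by
  have hD := psiPhase_denom_pos y hy
  have h := (((hasDerivAt_psiPhase_denom y θ).log (hD θ).ne').const_sub (Real.log y)).const_mul
    (1 / 2)
  have hf : psiPhase y = fun t : ℝ =>
      1 / 2 * (Real.log y - Real.log (Real.sin t ^ 2 * (y ^ 2 - 1) + 1)) := by
    ext t
    rw [psiPhase, Real.log_div hy.ne' (hD t).ne']
  rw [hf]
  exact h.congr_deriv (by ring)

theorem deriv_psiPhase (y : ℝ) (hy : 0 < y) :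
    deriv (psiPhase y) = fun θ : ℝ =>
      -(y ^ 2 - 1) * (Real.sin θ * Real.cos θ) / (Real.sin θ ^ 2 * (y ^ 2 - 1) + 1) :=
  funext fun θ => (hasDerivAt_psiPhase y hy θ).deriv

theorem iteratedDeriv_two_psiPhase (y : ℝ) (hy : 0 < y) (θ : ℝ) :
    iteratedDeriv 2 (psiPhase y) θ =
      -(y ^ 2 - 1) * ((Real.cos θ ^ 2 - Real.sin θ ^ 2) * (Real.sin θ ^ 2 * (y ^ 2 - 1) + 1)
        - 2 * Real.sin θ ^ 2 * Real.cos θ ^ 2 * (y ^ 2 - 1))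
        / (Real.sin θ ^ 2 * (y ^ 2 - 1) + 1) ^ 2 := by
  rw [iteratedDeriv_succ, iteratedDeriv_one, deriv_psiPhase y hy]
  have h := (((Real.hasDerivAt_sin θ).mul (Real.hasDerivAt_cos θ)).const_mul
    (-(y ^ 2 - 1))).div (hasDerivAt_psiPhase_denom y θ) (psiPhase_denom_pos y hy θ).ne'
  refine h.deriv.trans ?_
  simp only [Pi.mul_apply]
  ring

theorem iteratedDeriv_two_psiPhase_of_sin_eq_zero (y : ℝ) (hy : 0 < y) {θ : ℝ}
    (hs : Real.sin θ = 0) : iteratedDeriv 2 (psiPhase y) θ = 1 - y ^ 2 := by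
  have hc : Real.cos θ ^ 2 = 1 := by simp [Real.cos_sq', hs]
  rw [iteratedDeriv_two_psiPhase y hy, hc, hs]
  ring

theorem iteratedDeriv_two_psiPhase_of_cos_eq_zero (y : ℝ) (hy : 0 < y) {θ : ℝ}
    (hc : Real.cos θ = 0) : iteratedDeriv 2 (psiPhase y) θ = 1 - (y ^ 2)⁻¹ := by
  have hs : Real.sin θ ^ 2 = 1 := by simp [Real.sin_sq, hc]
  rw [iteratedDeriv_two_psiPhase y hy, hc, hs]
  field_simp
  ring

theorem deriv_psiPhase_eq_zero_iff (y : ℝ) (hy : 0 < y) (hy1 : y ≠ 1) (θ : ℝ) :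
    deriv (psiPhase y) θ = 0 ↔ Real.sin θ = 0 ∨ Real.cos θ = 0 := by
  have h1 : -(y ^ 2 - 1) ≠ 0 :=
    neg_ne_zero.mpr (sub_ne_zero.mpr fun h =>
      hy1 ((pow_eq_one_iff_of_nonneg hy.le two_ne_zero).mp h))
  rw [deriv_psiPhase y hy, div_eq_zero_iff, or_iff_left (psiPhase_denom_pos y hy θ).ne',
    mul_eq_zero, or_iff_right h1, mul_eq_zero]

/-- Properties of the phase function `ψ_y`: (a) `Im(k_θ·(iy)) = y/(sin²θ(y²−1)+1)` and
`φ_r(k_θ·(iy)) = e^{(2ir+1)ψ_y(θ)}`; (b) the critical points of `ψ_y` are exactly the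
points `πl/2`, `l ∈ ℤ`; (c) `ψ_y''(πl) = 1 − y²`, `ψ_y''(π/2+πl) = 1 − y⁻²`, and in
particular the second derivative is nonzero at every critical point. -/
theorem psi_phase_properties (y : ℝ) (hy : 0 < y) (hy1 : y ≠ 1) :
    (∀ θ : ℝ,
        (moebius (kMat θ) (Complex.I * y)).im
          = y / (Real.sin θ ^ 2 * (y ^ 2 - 1) + 1) ∧
        ∀ r : ℝ, phir r (moebius (kMat θ) (Complex.I * y))
          = Complex.exp ((2 * r * Complex.I + 1) * (psiPhase y θ : ℂ))) ∧
    (∀ θ : ℝ, deriv (psiPhase y) θ = 0 ↔ ∃ l : ℤ, θ = Real.pi * l / 2) ∧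
    (∀ l : ℤ, iteratedDeriv 2 (psiPhase y) (Real.pi * l) = 1 - y ^ 2) ∧
    (∀ l : ℤ, iteratedDeriv 2 (psiPhase y) (Real.pi / 2 + Real.pi * l) = 1 - (y ^ 2)⁻¹) ∧
    (∀ θ : ℝ, deriv (psiPhase y) θ = 0 → iteratedDeriv 2 (psiPhase y) θ ≠ 0) := by
  have hsq : y ^ 2 ≠ 1 := fun h => hy1 ((pow_eq_one_iff_of_nonneg hy.le two_ne_zero).mp h)
  refine ⟨fun θ => ⟨im_moebius_kMat y θ, fun r => ?_⟩, fun θ => ?_, fun l => ?_, fun l => ?_,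
    fun θ h => ?_⟩
  · have hpos := div_pos hy (psiPhase_denom_pos y hy θ)
    rw [phir, im_moebius_kMat, psiPhase, ← Complex.ofReal_log hpos.le]
    congr 1
    push_cast
    ring
  · rw [deriv_psiPhase_eq_zero_iff y hy hy1]
    have h2 : Real.sin (2 * θ) = 0 ↔ Real.sin θ = 0 ∨ Real.cos θ = 0 := by
      simp [Real.sin_two_mul]
    rw [← h2, Real.sin_eq_zero_iff]
    refine exists_congr fun l => ⟨fun h => ?_, fun h => ?_⟩ <;> linarith
  · exact iteratedDeriv_two_psiPhase_of_sin_eq_zero y hy (by rw [mul_comm, Real.sin_int_mul_pi])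
  · refine iteratedDeriv_two_psiPhase_of_cos_eq_zero y hy (Real.cos_eq_zero_iff.mpr ⟨l, ?_⟩)
    ring
  · rcases (deriv_psiPhase_eq_zero_iff y hy hy1 θ).mp h with hs | hc
    · rw [iteratedDeriv_two_psiPhase_of_sin_eq_zero y hy hs]
      exact sub_ne_zero.mpr hsq.symm
    · rw [iteratedDeriv_two_psiPhase_of_cos_eq_zero y hy hc]
      exact sub_ne_zero.mpr fun h => hsq (inv_eq_one.mp h.symm)

end
end

section
/- For every nonzero integer n there exists a constant C > 0 (depending only on n) such that for every δ ∈ (0,1) there exists an entire function F : ℂ → ℂ of finite exponential type (i.e. there exist A, B > 0 with |F(z)| ≤ B·e^{A|z|} for all z ∈ ℂ) satisfying: F(im/2) = 1 for every integer m with 1 ≤ |m| ≤ |n|, and |F(x)| ≤ C·δ for every real x. -/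
open Complex

noncomputable section

theorem norm_cos_le_exp_norm (w : ℂ) : ‖Complex.cos w‖ ≤ Real.exp ‖w‖ := by
  have h1 : ‖Complex.exp (w * I)‖ ≤ Real.exp ‖w‖ := by
    simpa using Complex.norm_exp_le_exp_norm (w * I)
  have h2 : ‖Complex.exp (-w * I)‖ ≤ Real.exp ‖w‖ := by
    simpa using Complex.norm_exp_le_exp_norm (-w * I)
  rw [Complex.cos, norm_div, Complex.norm_ofNat]
  have := norm_add_le (Complex.exp (w * I)) (Complex.exp (-w * I))
  linarith

/-- A rescaled cosine equals `1` at `±ia` and is uniformly small on the real line. -/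
theorem exists_entire_eq_one_at_pair {a δ : ℝ} (ha : 0 < a) (hδ : 0 < δ) :
    ∃ G : ℂ → ℂ, Differentiable ℂ G ∧
      (∃ A > 0, ∃ B > 0, ∀ z : ℂ, ‖G z‖ ≤ B * Real.exp (A * ‖z‖)) ∧
      G (a * I) = 1 ∧ G (-(a * I)) = 1 ∧ ∀ x : ℝ, ‖G x‖ ≤ δ := by
  set L : ℝ := 2 / (a * δ) with hL
  have hL0 : 0 < L := by positivity
  have hc : 0 < Real.cosh (L * a) := Real.cosh_pos _
  have hlow : 1 / δ ≤ Real.cosh (L * a) := by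
    have h1 := Real.add_one_le_exp (L * a)
    have h2 := Real.exp_pos (-(L * a))
    have h3 : L * a = 2 * (1 / δ) := by rw [hL]; field_simp
    rw [Real.cosh_eq]
    linarith
  have hc1 : (Complex.cosh (L * a) : ℂ) ≠ 0 := by
    exact_mod_cast hc.ne'
  have hn : ‖Complex.cosh (L * a)‖ = Real.cosh (L * a) := by
    rw [← Complex.ofReal_mul, ← Complex.ofReal_cosh, Complex.norm_real, Real.norm_of_nonneg hc.le]
  have hcos : Complex.cos (L * (a * I)) = Complex.cosh (L * a) := by
    rw [← mul_assoc, Complex.cos_mul_I]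
  refine ⟨fun z => Complex.cos (L * z) / Complex.cosh (L * a), by fun_prop,
    ⟨L, hL0, 1 / Real.cosh (L * a), by positivity, fun z => ?_⟩, ?_, ?_, fun x => ?_⟩
  · rw [norm_div, hn, one_div_mul_eq_div]
    gcongr
    simpa [abs_of_pos hL0] using norm_cos_le_exp_norm (L * z)
  · simp only [hcos, div_self hc1]
  · simp only [mul_neg, Complex.cos_neg, hcos, div_self hc1]
  · rw [norm_div, hn, ← Complex.ofReal_mul, ← Complex.ofReal_cos, Complex.norm_real, div_le_iff₀ hc]
    refine (Real.abs_cos_le_one _).trans ?_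
    rwa [div_le_iff₀' hδ] at hlow

theorem exists_entire_correction_nat (N : ℕ) :
    ∃ C : ℝ, C > 0 ∧ ∀ δ : ℝ, δ ∈ Set.Ioo (0 : ℝ) 1 →
      ∃ F : ℂ → ℂ, Differentiable ℂ F ∧
        (∃ A > 0, ∃ B > 0, ∀ z : ℂ, ‖F z‖ ≤ B * Real.exp (A * ‖z‖)) ∧
        (∀ m : ℤ, 1 ≤ |m| → |m| ≤ N → F (Complex.I * m / 2) = 1) ∧
        (∀ x : ℝ, ‖F (x : ℂ)‖ ≤ C * δ) := by
  induction N with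
  | zero =>
    refine ⟨1, one_pos, fun δ hδ => ⟨0, differentiable_const 0,
      ⟨1, one_pos, 1, one_pos, fun z => ?_⟩, fun m h1 h2 => ?_, fun x => ?_⟩⟩
    · simp only [Pi.zero_apply, norm_zero]; positivity
    · push_cast at h2; omega
    · simpa using hδ.1.le
  | succ N ih =>
    obtain ⟨C, hC, h⟩ := ih
    refine ⟨2 * C + 1, by positivity, fun δ hδ => ?_⟩
    obtain ⟨F, hF, ⟨A₁, hA₁, B₁, hB₁, hFb⟩, hF1, hFx⟩ := h δ hδ
    obtain ⟨G, hG, ⟨A₂, hA₂, B₂, hB₂, hGb⟩, hG1, hG2, hGx⟩ :=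
      exists_entire_eq_one_at_pair (a := ((N + 1 : ℕ) : ℝ) / 2) (by positivity) hδ.1
    have htri (z : ℂ) : ‖F z + G z - F z * G z‖ ≤ ‖F z‖ + ‖G z‖ + ‖F z‖ * ‖G z‖ := by
      rw [← norm_mul]
      exact (norm_sub_le _ _).trans (by gcongr; exact norm_add_le _ _)
    refine ⟨fun z => F z + G z - F z * G z, by fun_prop,
      ⟨A₁ + A₂, by positivity, B₁ + B₂ + B₁ * B₂, by positivity, fun z => (htri z).trans ?_⟩,
      fun m h1 h2 => ?_, fun x => (htri x).trans ?_⟩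
    · have e1 : Real.exp (A₁ * ‖z‖) ≤ Real.exp ((A₁ + A₂) * ‖z‖) := by gcongr; linarith
      have e2 : Real.exp (A₂ * ‖z‖) ≤ Real.exp ((A₁ + A₂) * ‖z‖) := by gcongr; linarith
      have e3 : Real.exp ((A₁ + A₂) * ‖z‖) = Real.exp (A₁ * ‖z‖) * Real.exp (A₂ * ‖z‖) := by
        rw [← Real.exp_add, add_mul]
      calc ‖F z‖ + ‖G z‖ + ‖F z‖ * ‖G z‖
          ≤ B₁ * Real.exp (A₁ * ‖z‖) + B₂ * Real.exp (A₂ * ‖z‖)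
            + (B₁ * Real.exp (A₁ * ‖z‖)) * (B₂ * Real.exp (A₂ * ‖z‖)) := by
              gcongr <;> first | exact hFb z | exact hGb z
        _ = B₁ * Real.exp (A₁ * ‖z‖) + B₂ * Real.exp (A₂ * ‖z‖)
            + B₁ * B₂ * Real.exp ((A₁ + A₂) * ‖z‖) := by rw [e3]; ring
        _ ≤ B₁ * Real.exp ((A₁ + A₂) * ‖z‖) + B₂ * Real.exp ((A₁ + A₂) * ‖z‖)
            + B₁ * B₂ * Real.exp ((A₁ + A₂) * ‖z‖) := by gcongr
        _ = _ := by ring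
    · rcases h2.lt_or_eq with hlt | heq
      · have := hF1 m h1 (by push_cast at hlt; omega)
        simp only [this]; ring
      · have hGm : G (Complex.I * m / 2) = 1 := by
          rcases (abs_eq (by positivity)).1 heq with rfl | rfl
          · rw [← hG1]; congr 1; push_cast; ring
          · rw [← hG2]; congr 1; push_cast; ring
        simp only [hGm]; ring
    · have hf := hFx x
      have hg := hGx x
      have hmul : ‖F x‖ * ‖G x‖ ≤ C * δ * 1 :=
        mul_le_mul hf (hg.trans hδ.2.le) (norm_nonneg _) (mul_nonneg hC.le hδ.1.le)
      linarith

/-- For every nonzero integer `n` there is a constant `C > 0` (depending only on `n`)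
such that for every `δ ∈ (0,1)` there is an entire function `F` of finite exponential
type with `F(im/2) = 1` for all integers `1 ≤ |m| ≤ |n|` and `|F(x)| ≤ C·δ` for all
real `x`. -/
theorem exists_entire_correction (n : ℤ) (hn : n ≠ 0) :
    ∃ C > 0, ∀ δ : ℝ, δ ∈ Set.Ioo (0 : ℝ) 1 →
      ∃ F : ℂ → ℂ, Differentiable ℂ F ∧
        (∃ A > 0, ∃ B > 0, ∀ z : ℂ, ‖F z‖ ≤ B * Real.exp (A * ‖z‖)) ∧
        (∀ m : ℤ, 1 ≤ |m| → |m| ≤ |n| → F (Complex.I * m / 2) = 1) ∧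
        (∀ x : ℝ, ‖F (x : ℂ)‖ ≤ C * δ) := by
  simpa only [Int.natCast_natAbs] using exists_entire_correction_nat n.natAbs

end
end

section
/- Fix a nonzero integer n and δ ∈ (0,1), and let G_δ(x) = sin(x/δ) · ∏_{1≤|m|≤|n|} (2x − im)/(x/δ − mπ), defined a priori for complex x avoiding the points δmπ (1 ≤ |m| ≤ |n|). Then: (a) G_δ extends to an entire function on ℂ; (b) G_δ(im/2) = 0 for every integer m with 1 ≤ |m| ≤ |n|; (c) there is a constant C > 0 depending only on n (not on δ) such that |G_δ(x)| ≤ C for all real x; (d) there exist constants c > 0 and δ₀ ∈ (0,1), depending only on n, such that for all δ < δ₀ and all integers m with 1 ≤ |m| ≤ |n|, the derivative satisfies |G_δ′(im/2)| ≥ c/δ. -/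
open Complex

noncomputable section

/-- The index set `{m ∈ ℤ : 1 ≤ |m| ≤ |n|}`. -/
def idxSet (n : ℤ) : Finset ℤ := (Finset.Icc (-|n|) |n|).filter (· ≠ 0)

/-- The function `G_δ(x) = sin(x/δ) · ∏_{1≤|m|≤|n|} (2x − im)/(x/δ − mπ)`. -/
def Gfun (n : ℤ) (δ : ℝ) (x : ℂ) : ℂ :=
  Complex.sin (x / (δ : ℂ)) *
    ∏ m ∈ idxSet n, (2 * x - Complex.I * m) / (x / (δ : ℂ) - m * Real.pi)

/-- Finitely many of the zeros of `sin` can be divided out, leaving an entire function. -/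
theorem exists_entire_mul_prod_eq_sin (s : Finset ℤ) :
    ∃ g : ℂ → ℂ, Differentiable ℂ g ∧
      ∀ z : ℂ, Complex.sin z = g z * ∏ m ∈ s, (z - m * Real.pi) := by
  induction s using Finset.induction_on with
  | empty => exact ⟨Complex.sin, Complex.differentiable_sin, by simp⟩
  | insert a s ha ih =>
    obtain ⟨g, hg, h⟩ := ih
    have hga : g (a * Real.pi) = 0 := by
      have h1 := h (a * Real.pi)
      rw [Complex.sin_int_mul_pi] at h1
      refine (mul_eq_zero.1 h1.symm).resolve_right (Finset.prod_ne_zero_iff.2 fun m hm => ?_)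
      have ham : (a : ℂ) - m ≠ 0 := by
        exact sub_ne_zero.2 (Int.cast_injective.ne fun ham => ha (ham ▸ hm))
      have hpi : (Real.pi : ℂ) ≠ 0 := by exact_mod_cast Real.pi_ne_zero
      rw [← sub_mul]
      exact mul_ne_zero ham hpi
    refine ⟨dslope g (a * Real.pi), ?_, fun z => ?_⟩
    · rw [← differentiableOn_univ] at hg ⊢
      exact (Complex.differentiableOn_dslope Filter.univ_mem).2 hg
    · have h2 := sub_smul_dslope g (a * Real.pi) z
      rw [hga, sub_zero, smul_eq_mul] at h2
      rw [Finset.prod_insert ha, h z, ← h2]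
      ring

theorem abs_sin_le_abs_sub_int_mul_pi (y : ℝ) (m : ℤ) :
    |Real.sin y| ≤ |y - m * Real.pi| := by
  have h := Real.abs_sin_le_abs (x := y - m * Real.pi)
  rwa [Real.sin_sub_int_mul_pi, abs_mul, abs_zpow, abs_neg, abs_one, one_zpow, one_mul] at h

theorem abs_sin_le_prod_min (s : Finset ℤ) (y : ℝ) :
    |Real.sin y| ≤ ∏ m ∈ s, min 1 |y - m * Real.pi| := by
  by_cases h : ∃ k ∈ s, |y - k * Real.pi| < 1
  · obtain ⟨k, hk, hky⟩ := h
    have hprod : ∏ m ∈ s, min 1 |y - m * Real.pi| = min 1 |y - k * Real.pi| := by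
      refine Finset.prod_eq_single_of_mem k hk fun m _ hmk => min_eq_left ?_
      have h1 : (1 : ℝ) ≤ |(k : ℝ) - m| := by
        exact_mod_cast Int.one_le_abs (sub_ne_zero.2 hmk.symm)
      have h2 : |((k : ℝ) - m) * Real.pi| ≤ |y - m * Real.pi| + |y - k * Real.pi| := by
        rw [show ((k : ℝ) - m) * Real.pi = y - m * Real.pi - (y - k * Real.pi) by ring]
        exact abs_sub _ _
      rw [abs_mul, abs_of_pos Real.pi_pos] at h2
      nlinarith [Real.pi_gt_three]
    rw [hprod]
    exact le_min (Real.abs_sin_le_one y) (abs_sin_le_abs_sub_int_mul_pi y k)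
  · push Not at h
    rw [Finset.prod_congr rfl fun m hm => min_eq_left (h m hm)]
    simpa using Real.abs_sin_le_one y

theorem ne_zero_of_mem_idxSet {n m : ℤ} (hm : m ∈ idxSet n) : m ≠ 0 :=
  (Finset.mem_filter.1 hm).2

theorem abs_le_of_mem_idxSet {n m : ℤ} (hm : m ∈ idxSet n) : |(m : ℝ)| ≤ |(n : ℝ)| := by
  have h := abs_le.2 (Finset.mem_Icc.1 (Finset.mem_filter.1 hm).1)
  exact_mod_cast h

theorem exists_entire_extension_Gfun (n : ℤ) {δ : ℝ} (hδ : 0 < δ) :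
    ∃ G' : ℂ → ℂ, Differentiable ℂ G' ∧
      ∀ x : ℂ, (∀ m ∈ idxSet n, x ≠ (δ : ℂ) * m * Real.pi) → G' x = Gfun n δ x := by
  obtain ⟨g, hg, h⟩ := exists_entire_mul_prod_eq_sin (idxSet n)
  have hδ' : (δ : ℂ) ≠ 0 := by exact_mod_cast hδ.ne'
  refine ⟨fun x => g (x / δ) * ∏ m ∈ idxSet n, (2 * x - Complex.I * m), ?_, fun x hx => ?_⟩
  · refine (hg.comp (differentiable_id.div_const _)).mul ?_
    exact Differentiable.fun_finsetProd fun m _ => by fun_prop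
  · have hne : ∏ m ∈ idxSet n, (x / (δ : ℂ) - m * Real.pi) ≠ 0 := by
      refine Finset.prod_ne_zero_iff.2 fun m hm => sub_ne_zero.2 fun h => hx m hm ?_
      rw [div_eq_iff hδ'] at h
      rw [h]
      ring
    rw [Gfun, Finset.prod_div_distrib, h (x / δ), mul_assoc, mul_div_cancel₀ _ hne]

theorem Gfun_eq_zero (n : ℤ) (δ : ℝ) {m : ℤ} (hm : m ∈ idxSet n) :
    Gfun n δ (Complex.I * m / 2) = 0 := by
  refine mul_eq_zero_of_right _ (Finset.prod_eq_zero hm ?_)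
  rw [mul_div_cancel₀ _ two_ne_zero, sub_self, zero_div]

theorem norm_Gfun_ofReal_le (n : ℤ) {δ : ℝ} (hδ : δ ∈ Set.Ioo (0 : ℝ) 1) (x : ℝ) :
    ‖Gfun n δ (x : ℂ)‖ ≤ (2 + 2 * |(n : ℝ)| * Real.pi + |(n : ℝ)|) ^ (idxSet n).card := by
  obtain ⟨hδ0, hδ1⟩ := hδ
  set y : ℝ := x / δ with hy
  have hx : |x| ≤ |y| := by
    have hxy : x = y * δ := by rw [hy, div_mul_cancel₀ _ hδ0.ne']
    rw [hxy, abs_mul, abs_of_pos hδ0]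
    exact mul_le_of_le_one_right (abs_nonneg y) hδ1.le
  have hsin : ‖Complex.sin ((x : ℂ) / δ)‖ = |Real.sin y| := by
    rw [← Complex.ofReal_div, ← Complex.ofReal_sin, Complex.norm_real, Real.norm_eq_abs]
  have hden (m : ℤ) : ‖(x : ℂ) / δ - m * Real.pi‖ = |y - m * Real.pi| := by
    rw [← Real.norm_eq_abs, ← Complex.norm_real]
    push_cast [hy]
    rfl
  rw [Gfun, norm_mul, norm_prod, hsin]
  refine (mul_le_mul_of_nonneg_right (abs_sin_le_prod_min (idxSet n) y)
    (Finset.prod_nonneg fun _ _ => norm_nonneg _)).trans ?_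
  rw [← Finset.prod_mul_distrib]
  rw [← Finset.prod_const]
  refine Finset.prod_le_prod (fun _ _ => by positivity) fun m hm => ?_
  have hnum : ‖2 * (x : ℂ) - Complex.I * m‖ ≤ 2 * |y| + |(n : ℝ)| := by
    refine (norm_sub_le _ _).trans ?_
    simp only [norm_mul, Complex.norm_ofNat, Complex.norm_real, Complex.norm_I, one_mul,
      Complex.norm_intCast, Real.norm_eq_abs]
    linarith [abs_le_of_mem_idxSet hm]
  set d := |y - m * Real.pi| with hd
  have hyd : |y| ≤ d + |(n : ℝ)| * Real.pi := by
    have h1 : |y| ≤ d + |m * Real.pi| := by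
      simpa using abs_add_le (y - m * Real.pi) (m * Real.pi)
    rw [abs_mul, abs_of_pos Real.pi_pos] at h1
    nlinarith [abs_le_of_mem_idxSet hm, Real.pi_pos]
  have hd0 : 0 ≤ d := abs_nonneg _
  have hM : 0 ≤ |(n : ℝ)| * Real.pi := by positivity
  have hN : 0 ≤ |(n : ℝ)| := abs_nonneg _
  rw [norm_div, hden, ← hd]
  rcases hd0.eq_or_lt with h0 | h0
  · rw [← h0, div_zero, mul_zero]
    positivity
  rw [← mul_div_assoc, div_le_iff₀ h0]
  rcases le_total d 1 with h1 | h1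
  · rw [min_eq_right h1, mul_comm]
    refine mul_le_mul_of_nonneg_right ?_ hd0
    linarith
  · rw [min_eq_left h1, one_mul]
    nlinarith

theorem pow_div_factorial_le_sinh (k : ℕ) {t : ℝ} (ht : 0 ≤ t) :
    t ^ (k + 1) / (k + 1).factorial / 2 ≤ Real.sinh t := by
  have h1 := Real.sum_le_exp_of_nonneg ht (k + 2)
  rw [Finset.sum_range_succ] at h1
  have h2 : (1 : ℝ) ≤ ∑ i ∈ Finset.range (k + 1), t ^ i / i.factorial := by
    have := Finset.single_le_sum (f := fun i : ℕ => t ^ i / (i.factorial : ℝ))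
      (fun i _ => by positivity) (Finset.mem_range.2 k.succ_pos)
    simpa using this
  have h3 : Real.exp (-t) ≤ 1 := Real.exp_le_one_iff.2 (neg_nonpos.2 ht)
  rw [Real.sinh_eq]
  linarith

theorem norm_sin_ofReal_mul_I (t : ℝ) : ‖Complex.sin (t * Complex.I)‖ = Real.sinh |t| := by
  rw [Complex.sin_mul_I, norm_mul, Complex.norm_I, mul_one, ← Complex.ofReal_sinh,
    Complex.norm_real, Real.norm_eq_abs, Real.abs_sinh]

theorem I_mul_div_sub_int_mul_pi_ne_zero {k : ℤ} (hk : k ≠ 0) (m : ℤ) (δ : ℝ) :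
    Complex.I * m / 2 / (δ : ℂ) - k * Real.pi ≠ 0 := fun h => by
  have hre := congrArg Complex.re h
  have him : Complex.I * m / 2 / (δ : ℂ) = ((m / 2 / δ : ℝ) : ℂ) * Complex.I := by
    push_cast
    ring
  rw [him] at hre
  simp [Real.pi_ne_zero, hk] at hre

theorem norm_deriv_Gfun {n m : ℤ} (hm : m ∈ idxSet n) {δ : ℝ} (hδ : 0 < δ) :
    ‖deriv (Gfun n δ) (Complex.I * m / 2)‖ =
      2 * (Real.sinh (|(m : ℝ)| / (2 * δ)) * ((∏ k ∈ (idxSet n).erase m, |(m : ℝ) - k|) /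
        ∏ k ∈ idxSet n, ‖Complex.I * m / 2 / (δ : ℂ) - k * Real.pi‖)) := by
  set a : ℂ := Complex.I * m / 2 with ha
  set H : ℂ → ℂ := fun x => Complex.sin (x / δ) *
    ((∏ k ∈ (idxSet n).erase m, (2 * x - Complex.I * k)) /
      ∏ k ∈ idxSet n, (x / (δ : ℂ) - k * Real.pi)) with hH
  have hG : Gfun n δ = fun x => (2 * x - Complex.I * m) * H x := by
    funext x
    rw [Gfun, Finset.prod_div_distrib, ← Finset.mul_prod_erase _ _ hm, hH]
    ring
  have hden : ∏ k ∈ idxSet n, (a / (δ : ℂ) - k * Real.pi) ≠ 0 := by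
    exact Finset.prod_ne_zero_iff.2 fun k hk =>
      I_mul_div_sub_int_mul_pi_ne_zero (ne_zero_of_mem_idxSet hk) m δ
  have hdiff : DifferentiableAt ℂ H a := by
    refine DifferentiableAt.mul (by fun_prop) (DifferentiableAt.div ?_ ?_ hden)
    · exact DifferentiableAt.fun_finsetProd fun k _ => by fun_prop
    · exact DifferentiableAt.fun_finsetProd fun k _ => by fun_prop
  have hlin : HasDerivAt (fun x : ℂ => 2 * x - Complex.I * m) 2 a := by
    simpa using ((hasDerivAt_id a).const_mul 2).sub_const (Complex.I * m)
  have hzero : 2 * a - Complex.I * m = 0 := by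
    rw [ha]
    ring
  have hd : deriv (Gfun n δ) a = 2 * H a := by
    rw [hG, (hlin.fun_mul hdiff.hasDerivAt).deriv, hzero, zero_mul, add_zero]
  have hsin : ‖Complex.sin (a / δ)‖ = Real.sinh (|(m : ℝ)| / (2 * δ)) := by
    have him : a / δ = ((m / (2 * δ) : ℝ) : ℂ) * Complex.I := by
      rw [ha]
      push_cast
      ring
    rw [him, norm_sin_ofReal_mul_I, abs_div, abs_of_pos (by positivity : 0 < 2 * δ)]
  have hnum (k : ℤ) : ‖2 * a - Complex.I * k‖ = |(m : ℝ) - k| := by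
    rw [show 2 * a - Complex.I * k = Complex.I * ((m - k : ℤ) : ℂ) by rw [ha]; push_cast; ring,
      norm_mul, Complex.norm_I, one_mul, Complex.norm_intCast, Int.cast_sub]
  rw [hd, norm_mul, Complex.norm_ofNat, hH]
  simp only [norm_mul, norm_div, norm_prod, hnum, hsin]

theorem le_norm_deriv_Gfun {n m : ℤ} (hm : m ∈ idxSet n) {δ : ℝ} (hδ : δ ∈ Set.Ioo (0 : ℝ) 1) :
    (1 / 2) ^ ((idxSet n).card + 1) / ((idxSet n).card + 1).factorial /
      (|(n : ℝ)| * (1 / 2 + Real.pi)) ^ (idxSet n).card / δ ≤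
        ‖deriv (Gfun n δ) (Complex.I * m / 2)‖ := by
  obtain ⟨hδ0, hδ1⟩ := hδ
  rw [norm_deriv_Gfun hm hδ0]
  set N : ℝ := |(n : ℝ)|
  set p := (idxSet n).card with hp
  have hm1 : (1 : ℝ) ≤ |(m : ℝ)| := by
    exact_mod_cast Int.one_le_abs (ne_zero_of_mem_idxSet hm)
  have hN : 0 < N := by linarith [abs_le_of_mem_idxSet hm]
  have hsinh : (1 / (2 * δ)) ^ (p + 1) / (p + 1).factorial / 2 ≤
      Real.sinh (|(m : ℝ)| / (2 * δ)) :=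
    (pow_div_factorial_le_sinh p (by positivity)).trans
      (Real.sinh_le_sinh.2 (div_le_div_of_nonneg_right hm1 (by positivity)))
  have hnum : 1 ≤ ∏ k ∈ (idxSet n).erase m, |(m : ℝ) - k| := by
    rw [← Finset.prod_const_one (s := (idxSet n).erase m)]
    refine Finset.prod_le_prod (fun _ _ => zero_le_one) fun k hk => ?_
    exact_mod_cast Int.one_le_abs (sub_ne_zero.2 (Finset.ne_of_mem_erase hk).symm)
  have hden : ∏ k ∈ idxSet n, ‖Complex.I * m / 2 / (δ : ℂ) - k * Real.pi‖ ≤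
      (N * (1 / 2 + Real.pi) / δ) ^ p := by
    rw [hp, ← Finset.prod_const]
    refine Finset.prod_le_prod (fun _ _ => norm_nonneg _) fun k hk => ?_
    refine (norm_sub_le _ _).trans ?_
    simp only [norm_mul, norm_div, Complex.norm_ofNat, Complex.norm_real, Complex.norm_I,
      one_mul, Complex.norm_intCast, Real.norm_eq_abs, abs_of_pos hδ0, abs_of_pos Real.pi_pos]
    rw [le_div_iff₀ hδ0, add_mul, div_mul_cancel₀ _ hδ0.ne']
    have h1 : |(k : ℝ)| * Real.pi * δ ≤ N * Real.pi * 1 := by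
      gcongr
      exact abs_le_of_mem_idxSet hk
    linarith [abs_le_of_mem_idxSet hm]
  have hden0 : 0 < ∏ k ∈ idxSet n, ‖Complex.I * m / 2 / (δ : ℂ) - k * Real.pi‖ := by
    exact Finset.prod_pos fun k hk => norm_pos_iff.2
      (I_mul_div_sub_int_mul_pi_ne_zero (ne_zero_of_mem_idxSet hk) m δ)
  have hpi := Real.pi_pos
  calc _ = 2 * ((1 / (2 * δ)) ^ (p + 1) / (p + 1).factorial / 2 *
        (1 / (N * (1 / 2 + Real.pi) / δ) ^ p)) := by
        simp only [div_pow, mul_pow, one_pow, pow_succ]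
        field_simp
    _ ≤ _ := by gcongr

/-- Properties of `G_δ`: (a) it extends to an entire function; (b) it vanishes at the
points `im/2`, `1 ≤ |m| ≤ |n|`; (c) it is bounded on ℝ by a constant depending only on
`n`; (d) its derivative at the points `im/2` is at least `c/δ` for small `δ`, with `c`
and the threshold `δ₀` depending only on `n`. -/
theorem Gfun_properties (n : ℤ) (hn : n ≠ 0) :
    (∀ δ ∈ Set.Ioo (0 : ℝ) 1,
      (∃ G' : ℂ → ℂ, Differentiable ℂ G' ∧
        ∀ x : ℂ, (∀ m ∈ idxSet n, x ≠ (δ : ℂ) * m * Real.pi) → G' x = Gfun n δ x) ∧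
      (∀ m ∈ idxSet n, Gfun n δ (Complex.I * m / 2) = 0)) ∧
    (∃ C > 0, ∀ δ ∈ Set.Ioo (0 : ℝ) 1, ∀ x : ℝ, ‖Gfun n δ (x : ℂ)‖ ≤ C) ∧
    (∃ c > 0, ∃ δ₀ ∈ Set.Ioo (0 : ℝ) 1, ∀ δ ∈ Set.Ioo (0 : ℝ) 1, δ < δ₀ →
      ∀ m ∈ idxSet n, c / δ ≤ ‖deriv (Gfun n δ) (Complex.I * m / 2)‖) := by
  have hN : 0 < |(n : ℝ)| := abs_pos.2 (Int.cast_ne_zero.2 hn)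
  have hpi := Real.pi_pos
  refine ⟨fun δ hδ => ⟨exists_entire_extension_Gfun n hδ.1, fun m hm => Gfun_eq_zero n δ hm⟩,
    ⟨_, ?_, fun δ hδ x => norm_Gfun_ofReal_le n hδ x⟩,
    ⟨_, ?_, 1 / 2, by norm_num, fun δ hδ _ m hm => le_norm_deriv_Gfun hm hδ⟩⟩
  · positivity
  · positivity

end
end

section
/- Let n be an integer and let f : ℍ → ℂ be a continuous, compactly supported function satisfying the equivariance f(k_θ·z) = e^{2inθ}·f(z) for all θ ∈ ℝ and z ∈ ℍ. Then for every r ∈ ℝ and every α ∈ ℝ, the Helgason–Fourier transform of f satisfies ∫_ℍ f(z)·φ_{−r}(k_α^{−1}·z) dμ(z) = e^{2inα} · 𝒮_n f(−r), where 𝒮_n f(−r) = ∫_ℍ f(z)·Φ_{−r,−n}(z) dμ(z). -/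
open MeasureTheory Complex

noncomputable section

/-- The hyperbolic measure `dμ = dx·dy/y²` on the upper half-plane, viewed as a
measure on ℂ supported on `{z : 0 < Im z}`. -/
def hypMeasure : Measure ℂ :=
  (volume.withDensity fun z => ENNReal.ofReal ((z.im)⁻¹ ^ 2)).restrict {z : ℂ | 0 < z.im}

/-- The `n`-spherical transform `𝒮_n f(r) = ∫_ℍ f(z)·Φ_{r,−n}(z) dμ(z)`. -/
def sphTransform (n : ℤ) (f : ℂ → ℂ) (r : ℝ) : ℂ :=
  ∫ z, f z * sphFn r (-n) z ∂hypMeasure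

/-- The rotation `k_θ` as an element of `SL(2,ℝ)`. -/
def rotSL (θ : ℝ) : Matrix.SpecialLinearGroup (Fin 2) ℝ :=
  ⟨kMat θ, by simp [kMat, Matrix.det_fin_two, ← sq]⟩

/-- The rotation `k_θ` as an element of `GL(2,ℝ)`. -/
def rotGL (θ : ℝ) : GL (Fin 2) ℝ := (rotSL θ : GL (Fin 2) ℝ)

lemma coe_rotGL_smul (θ : ℝ) (τ : UpperHalfPlane) :
    ((rotGL θ • τ : UpperHalfPlane) : ℂ) = moebius (kMat θ) τ := by
  change ((rotSL θ • τ : UpperHalfPlane) : ℂ) = _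
  rw [UpperHalfPlane.coe_specialLinearGroup_apply]
  simp [moebius, rotSL]

lemma rotSL_neg (θ : ℝ) : rotSL (-θ) = (rotSL θ)⁻¹ := by
  ext i j
  rw [Matrix.SpecialLinearGroup.coe_inv, Matrix.adjugate_fin_two]
  fin_cases i <;> fin_cases j <;> simp [rotSL, kMat]

lemma rotGL_neg_smul_rotGL_smul (θ : ℝ) (τ : UpperHalfPlane) :
    rotGL (-θ) • rotGL θ • τ = τ := by
  change rotSL (-θ) • rotSL θ • τ = τ
  rw [rotSL_neg, inv_smul_smul]

lemma hypMeasure_eq_map :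
    hypMeasure = (volume : Measure UpperHalfPlane).map UpperHalfPlane.coe := by
  have hm : MeasurableSet {z : ℂ | 0 < z.im} := measurableSet_lt measurable_const measurable_im
  ext s hs
  rw [Measure.map_apply UpperHalfPlane.measurable_coe hs, UpperHalfPlane.volume_eq_lintegral,
    Set.image_preimage_eq_inter_range, UpperHalfPlane.range_coe, hypMeasure,
    Measure.restrict_apply hs, withDensity_apply _ (hs.inter hm)]
  refine setLIntegral_congr_fun (hs.inter hm) fun z hz => ?_
  have hz : 0 < z.im := hz.2
  rw [ENNReal.ofReal]
  congr 1
  ext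
  simp [abs_of_pos hz]
  positivity

lemma integral_hypMeasure (g : ℂ → ℂ) :
    ∫ z, g z ∂hypMeasure = ∫ τ : UpperHalfPlane, g τ := by
  rw [hypMeasure_eq_map, UpperHalfPlane.measurableEmbedding_coe.integral_map]

lemma helgason_fourier_eq_exp_mul {n : ℤ} {f : ℂ → ℂ}
    (hequi : ∀ θ : ℝ, ∀ z : ℂ, 0 < z.im →
      f (moebius (kMat θ) z) = Complex.exp (2 * n * θ * Complex.I) * f z) (φ : ℂ → ℂ) (α : ℝ) :
    ∫ τ : UpperHalfPlane, f τ * φ (moebius (kMat (-α)) τ)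
      = Complex.exp (2 * n * α * Complex.I) * ∫ τ : UpperHalfPlane, f τ * φ τ := by
  rw [← integral_smul_eq_self (g := rotGL α), ← integral_const_mul]
  refine integral_congr_ae (.of_forall fun τ => ?_)
  beta_reduce
  rw [← coe_rotGL_smul, rotGL_neg_smul_rotGL_smul, coe_rotGL_smul, hequi _ _ τ.im_pos, mul_assoc]

lemma continuous_phir_moebius_kMat (r : ℝ) :
    Continuous fun p : UpperHalfPlane × ℝ => phir r (moebius (kMat (-p.2)) p.1) := by
  have hden (p : UpperHalfPlane × ℝ) :
      ((kMat (-p.2) 1 0 : ℂ) * p.1 + (kMat (-p.2) 1 1 : ℂ)) ≠ 0 := by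
    exact UpperHalfPlane.denom_ne_zero (rotGL (-p.2)) p.1
  have hmoeb : Continuous fun p : UpperHalfPlane × ℝ => moebius (kMat (-p.2)) p.1 := by
    refine Continuous.div ?_ ?_ hden <;> simp only [kMat] <;> simp <;> fun_prop
  have him (p : UpperHalfPlane × ℝ) : 0 < (moebius (kMat (-p.2)) p.1).im := by
    rw [← coe_rotGL_smul]
    exact (rotGL (-p.2) • p.1).im_pos
  refine Complex.continuous_exp.comp (continuous_const.mul (Continuous.clog ?_ fun p => ?_))
  · exact continuous_ofReal.comp (continuous_im.comp hmoeb)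
  · exact ofReal_mem_slitPlane.mpr (him p)

lemma integrable_prod_of_continuous_of_compact {X : Type*} [TopologicalSpace X]
    [SecondCountableTopology X] [MeasurableSpace X] [BorelSpace X] [T2Space X] {μ : Measure X}
    [IsFiniteMeasureOnCompacts μ] [SFinite μ]
    {F : X × ℝ → ℂ} (hF : Continuous F) {K : Set X} (hK : IsCompact K)
    (hFK : ∀ p : X × ℝ, p.1 ∉ K → F p = 0) (a b : ℝ) :
    Integrable F (μ.prod (volume.restrict (Set.Ioc a b))) := by
  have h1 : IntegrableOn F (K ×ˢ Set.Icc a b) (μ.prod volume) :=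
    hF.continuousOn.integrableOn_compact (hK.prod isCompact_Icc)
  have h2 : IntegrableOn F (K ×ˢ Set.univ) (μ.prod (volume.restrict (Set.Ioc a b))) := by
    rw [IntegrableOn, ← Measure.prod_restrict, Measure.restrict_univ, Measure.prod_restrict]
    exact h1.mono_set (Set.prod_mono_right Set.Ioc_subset_Icc_self)
  rw [integrableOn_iff_integrable_of_support_subset] at h2
  · exact h2
  · intro p hp
    exact ⟨by_contra fun h => hp (hFK p h), trivial⟩

/-- For `f` continuous, compactly supported in ℍ and `K`-equivariant of weight `n`,
the Helgason–Fourier transform satisfies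
`∫_ℍ f(z)·φ_{−r}(k_α⁻¹·z) dμ(z) = e^{2inα} · 𝒮_n f(−r)` (note `k_α⁻¹ = k_{-α}`). -/
theorem helgason_fourier_of_Ktype (n : ℤ) (f : ℂ → ℂ) (hf : Continuous f)
    (hsupp : HasCompactSupport f) (hsuppH : tsupport f ⊆ {z : ℂ | 0 < z.im})
    (hequi : ∀ θ : ℝ, ∀ z : ℂ, 0 < z.im →
      f (moebius (kMat θ) z) = Complex.exp (2 * n * θ * Complex.I) * f z) :
    ∀ r α : ℝ,
      ∫ z, f z * phir (-r) (moebius (kMat (-α)) z) ∂hypMeasure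
        = Complex.exp (2 * n * α * Complex.I) * sphTransform n f (-r) := by
  intro r α
  have hcompact : IsCompact (UpperHalfPlane.coe ⁻¹' tsupport f) :=
    UpperHalfPlane.isOpenEmbedding_coe.isInducing.isCompact_preimage' hsupp.isCompact <|
      hsuppH.trans UpperHalfPlane.range_coe.ge
  have hinteg : Integrable (fun p : UpperHalfPlane × ℝ => f p.1 *
      (phir (-r) (moebius (kMat (-p.2)) p.1) * Complex.exp (2 * ((-n : ℤ) : ℂ) * p.2 * Complex.I)))
      ((volume : Measure UpperHalfPlane).prod (volume.restrict (Set.Ioc 0 Real.pi))) := by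
    refine integrable_prod_of_continuous_of_compact ?_ hcompact ?_ _ _
    · exact (hf.comp (UpperHalfPlane.continuous_coe.comp continuous_fst)).mul
        ((continuous_phir_moebius_kMat (-r)).mul (by fun_prop))
    · intro p hp
      rw [image_eq_zero_of_notMem_tsupport hp, zero_mul]
  have hπ : (Real.pi : ℂ) ≠ 0 := ofReal_ne_zero.mpr Real.pi_ne_zero
  rw [integral_hypMeasure, helgason_fourier_eq_exp_mul hequi, sphTransform, integral_hypMeasure]
  congr 1
  simp_rw [sphFn, mul_left_comm (f _), integral_const_mul,
    intervalIntegral.integral_of_le Real.pi_pos.le, ← integral_const_mul (f _)]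
  rw [integral_integral_swap hinteg]
  have hinner (θ : ℝ) : ∫ τ : UpperHalfPlane, f τ * (phir (-r) (moebius (kMat (-θ)) τ) *
      Complex.exp (2 * ((-n : ℤ) : ℂ) * θ * Complex.I)) =
      ∫ τ : UpperHalfPlane, f τ * phir (-r) τ := by
    simp_rw [← mul_assoc (f _)]
    rw [integral_mul_const, helgason_fourier_eq_exp_mul hequi, mul_right_comm, ← Complex.exp_add]
    simp
  simp_rw [hinner]
  simp [Real.pi_pos.le, hπ]

end
end

section
/- For every r ∈ ℝ and every integer n, the generalized spherical function Φ_{r,n} satisfies: (a) Φ_{r,n}(k_α·z) = e^{2inα}·Φ_{r,n}(z) for all α ∈ ℝ and z ∈ ℍ; (b) Φ_{r,n} is smooth and is an eigenfunction of the hyperbolic Laplacian with eigenvalue −(1/4 + r²), i.e. y²·(∂²Φ_{r,n}/∂x² + ∂²Φ_{r,n}/∂y²)(z) = −(1/4 + r²)·Φ_{r,n}(z) for all z = x+iy ∈ ℍ. -/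
open Complex

noncomputable section

section ParametricIntegral

open Set Filter Topology

variable {H E : Type*} [NormedAddCommGroup H] [NormedSpace ℝ H]
  [NormedAddCommGroup E] [NormedSpace ℝ E]

theorem ContDiffOn.fderiv_partial_fst {f : H → ℝ → E} {U : Set H} (hU : IsOpen U)
    (hf : ContDiffOn ℝ (⊤ : ℕ∞) (fun p : H × ℝ => f p.1 p.2) (U ×ˢ univ)) :
    (∀ x ∈ U, ∀ t, HasFDerivAt (fun x => f x t) (fderiv ℝ (fun x => f x t) x) x) ∧
    ContDiffOn ℝ (⊤ : ℕ∞) (fun p : H × ℝ => fderiv ℝ (fun x => f x p.2) p.1) (U ×ˢ univ) := by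
  have hV : IsOpen (U ×ˢ (univ : Set ℝ)) := hU.prod isOpen_univ
  have key : ∀ x ∈ U, ∀ t, HasFDerivAt (fun x => f x t)
      ((fderiv ℝ (fun p : H × ℝ => f p.1 p.2) (x, t)).comp (ContinuousLinearMap.inl ℝ H ℝ)) x := by
    intro x hx t
    have h1 : HasFDerivAt (fun p : H × ℝ => f p.1 p.2) _ (x, t) :=
      ((hf.differentiableOn (by simp)).differentiableAt
        (hV.mem_nhds (show (x, t) ∈ U ×ˢ univ from ⟨hx, mem_univ t⟩))).hasFDerivAt
    exact h1.comp (f := fun e => (e, t)) x (hasFDerivAt_prodMk_left x t)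
  refine ⟨fun x hx t => (key x hx t).differentiableAt.hasFDerivAt, ?_⟩
  have h2 : ContDiffOn ℝ (⊤ : ℕ∞) (fderiv ℝ (fun p : H × ℝ => f p.1 p.2)) (U ×ˢ univ) :=
    hf.fderiv_of_isOpen hV (by simp)
  refine (h2.clm_comp (contDiffOn_const (c := ContinuousLinearMap.inl ℝ H ℝ))).congr fun p hp => ?_
  exact (key p.1 hp.1 p.2).fderiv

theorem ContDiffOn.continuous_right {f : H → ℝ → E} {U : Set H}
    (hf : ContDiffOn ℝ (⊤ : ℕ∞) (fun p : H × ℝ => f p.1 p.2) (U ×ˢ univ)) {x : H} (hx : x ∈ U) :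
    Continuous (f x) :=
  hf.continuousOn.comp_continuous (f := fun t => (x, t)) (by fun_prop) fun t => ⟨hx, mem_univ t⟩

theorem ContDiffOn.hasFDerivAt_intervalIntegral [ProperSpace H] {f : H → ℝ → E} {U : Set H}
    (hU : IsOpen U)
    (hf : ContDiffOn ℝ (⊤ : ℕ∞) (fun p : H × ℝ => f p.1 p.2) (U ×ˢ univ))
    (a b : ℝ) {x : H} (hx : x ∈ U) :
    HasFDerivAt (fun x => ∫ t in a..b, f x t)
      (∫ t in a..b, fderiv ℝ (fun x => f x t) x) x := by
  obtain ⟨hd, hf'⟩ := hf.fderiv_partial_fst hU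
  obtain ⟨ε, hε, hball⟩ := Metric.nhds_basis_closedBall.mem_iff.1 (hU.mem_nhds hx)
  obtain ⟨C, hC⟩ := ((isCompact_closedBall x ε).prod (isCompact_uIcc (a := a) (b := b))
    ).exists_bound_of_continuousOn (hf'.continuousOn.mono (prod_mono hball (subset_univ _)))
  refine intervalIntegral.hasFDerivAt_integral_of_dominated_of_fderiv_le
    (F' := fun x t => fderiv ℝ (fun x => f x t) x) (bound := fun _ => C)
    (Metric.closedBall_mem_nhds x hε) ?_ ?_ ?_ ?_ ?_ ?_
  · filter_upwards [hU.mem_nhds hx] with y hy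
    exact (hf.continuous_right hy).aestronglyMeasurable
  · exact (hf.continuous_right hx).intervalIntegrable _ _
  · exact (hf'.continuous_right (f := fun x t => fderiv ℝ (fun x => f x t) x) hx
      ).aestronglyMeasurable
  · exact Eventually.of_forall fun t ht y hy => hC (y, t) ⟨hy, uIoc_subset_uIcc ht⟩
  · exact intervalIntegrable_const
  · exact Eventually.of_forall fun t _ y hy => hd y (hball hy) t

theorem ContDiffOn.intervalIntegral_nat.{u} {H : Type u} [NormedAddCommGroup H] [NormedSpace ℝ H]
    [ProperSpace H] {U : Set H} (hU : IsOpen U) (a b : ℝ) (n : ℕ) :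
    ∀ {E : Type u} [NormedAddCommGroup E] [NormedSpace ℝ E] {f : H → ℝ → E},
      ContDiffOn ℝ (⊤ : ℕ∞) (fun p : H × ℝ => f p.1 p.2) (U ×ˢ univ) →
      ContDiffOn ℝ n (fun x => ∫ t in a..b, f x t) U := by
  induction n with
  | zero =>
    intro E _ _ f hf
    simp only [Nat.cast_zero, contDiffOn_zero]
    exact fun x hx =>
      (hf.hasFDerivAt_intervalIntegral hU a b hx).continuousAt.continuousWithinAt
  | succ n ih =>
    intro E _ _ f hf
    have hd := fun x (hx : x ∈ U) => hf.hasFDerivAt_intervalIntegral hU a b hx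
    push_cast
    rw [contDiffOn_succ_iff_fderiv_of_isOpen hU]
    refine ⟨fun x hx => (hd x hx).differentiableAt.differentiableWithinAt, by simp, ?_⟩
    exact (ih (hf.fderiv_partial_fst hU).2).congr fun x hx => (hd x hx).fderiv

theorem ContDiffOn.deriv_partial_fst {f : ℝ → ℝ → E} {U : Set ℝ} (hU : IsOpen U)
    (hf : ContDiffOn ℝ (⊤ : ℕ∞) (fun p : ℝ × ℝ => f p.1 p.2) (U ×ˢ univ)) :
    ContDiffOn ℝ (⊤ : ℕ∞) (fun p : ℝ × ℝ => deriv (fun x => f x p.2) p.1) (U ×ˢ univ) :=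
  (hf.fderiv_partial_fst hU).2.clm_apply contDiffOn_const

theorem ContDiffOn.deriv_intervalIntegral [CompleteSpace E] {f : ℝ → ℝ → E} {U : Set ℝ}
    (hU : IsOpen U)
    (hf : ContDiffOn ℝ (⊤ : ℕ∞) (fun p : ℝ × ℝ => f p.1 p.2) (U ×ˢ univ))
    (a b : ℝ) {x : ℝ} (hx : x ∈ U) :
    deriv (fun x => ∫ t in a..b, f x t) x = ∫ t in a..b, deriv (fun x => f x t) x := by
  rw [(hf.hasFDerivAt_intervalIntegral hU a b hx).hasDerivAt.deriv,
    ContinuousLinearMap.intervalIntegral_apply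
      (((hf.fderiv_partial_fst hU).2.continuous_right
        (f := fun x t => fderiv ℝ (fun x => f x t) x) hx).intervalIntegrable _ _)]
  rfl

theorem ContDiffOn.deriv_deriv_intervalIntegral [CompleteSpace E] {f : ℝ → ℝ → E} {U : Set ℝ}
    (hU : IsOpen U)
    (hf : ContDiffOn ℝ (⊤ : ℕ∞) (fun p : ℝ × ℝ => f p.1 p.2) (U ×ˢ univ))
    (a b : ℝ) {x : ℝ} (hx : x ∈ U) :
    deriv (fun x' => deriv (fun x => ∫ t in a..b, f x t) x') x
      = ∫ t in a..b, deriv (fun x' => deriv (fun x => f x t) x') x := by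
  rw [← (hf.deriv_partial_fst hU).deriv_intervalIntegral hU
    (f := fun x t => deriv (fun x => f x t) x) a b hx]
  refine EventuallyEq.deriv_eq ?_
  filter_upwards [hU.mem_nhds hx] with y hy using hf.deriv_intervalIntegral hU a b hy

end ParametricIntegral

/-- `|sin θ · z + cos θ|²`, the denominator of `Im (k_θ⁻¹ · z) = Im z / |sin θ · z + cos θ|²`. -/
def kDenom (z : ℂ) (θ : ℝ) : ℝ :=
  (z.re * Real.sin θ + Real.cos θ) ^ 2 + (z.im * Real.sin θ) ^ 2

theorem kDenom_pos {z : ℂ} (hz : 0 < z.im) (θ : ℝ) : 0 < kDenom z θ := by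
  unfold kDenom
  rcases eq_or_ne (Real.sin θ) 0 with h | h
  · have := Real.sin_sq_add_cos_sq θ
    rw [h] at this ⊢
    nlinarith
  · positivity

theorem normSq_sin_mul_add_cos (z : ℂ) (θ : ℝ) :
    normSq (Real.sin θ * z + Real.cos θ) = kDenom z θ := by
  rw [normSq_apply, kDenom]
  simp only [add_re, add_im, re_ofReal_mul, im_ofReal_mul, ofReal_re, ofReal_im]
  ring

theorem im_moebius_kMat_neg (z : ℂ) (θ : ℝ) :
    (moebius (kMat (-θ)) z).im = z.im / kDenom z θ := by
  have h : moebius (kMat (-θ)) z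
      = (Real.cos θ * z - Real.sin θ) / (Real.sin θ * z + Real.cos θ) := by
    simp [moebius, kMat, sub_eq_add_neg]
  rw [h, div_im, normSq_sin_mul_add_cos, ← sub_div]
  congr 1
  simp only [add_re, add_im, sub_re, sub_im, re_ofReal_mul, im_ofReal_mul, ofReal_re, ofReal_im]
  linear_combination z.im * Real.sin_sq_add_cos_sq θ

theorem sin_mul_add_cos_ne_zero {z : ℂ} (hz : 0 < z.im) (θ : ℝ) :
    (Real.sin θ * z + Real.cos θ : ℂ) ≠ 0 := by
  rw [← normSq_pos, normSq_sin_mul_add_cos]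
  exact kDenom_pos hz θ

theorem moebius_kMat_neg_moebius_kMat {z : ℂ} (hz : 0 < z.im) (θ α : ℝ) :
    moebius (kMat (-θ)) (moebius (kMat α) z) = moebius (kMat (-(θ - α))) z := by
  have h1 := sin_mul_add_cos_ne_zero hz (-α)
  simp only [moebius, kMat, Real.sin_neg, Real.cos_neg, Real.sin_sub, Real.cos_sub,
    Matrix.of_apply, Matrix.cons_val', Matrix.cons_val_zero, Matrix.cons_val_one,
    Matrix.cons_val_fin_one] at h1 ⊢
  push_cast at h1 ⊢
  have hden : sin θ * ((cos α * z + sin α) / (-sin α * z + cos α)) + cos θ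
      = ((sin θ * cos α - cos θ * sin α) * z + (cos θ * cos α + sin θ * sin α))
        / (-sin α * z + cos α) := by
    rw [mul_div_assoc', div_add' _ _ _ h1]
    ring
  have hnum : cos θ * ((cos α * z + sin α) / (-sin α * z + cos α)) + -sin θ
      = ((cos θ * cos α + sin θ * sin α) * z + -(sin θ * cos α - cos θ * sin α))
        / (-sin α * z + cos α) := by
    rw [mul_div_assoc', div_add' _ _ _ h1]
    ring
  simp only [neg_neg]
  rw [hden, hnum, div_div_div_cancel_right₀ h1]

theorem moebius_kMat_neg_add_pi (z : ℂ) (θ : ℝ) :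
    moebius (kMat (-(θ + Real.pi))) z = moebius (kMat (-θ)) z := by
  simp only [moebius, kMat, Real.sin_neg, Real.cos_neg, Real.sin_add_pi, Real.cos_add_pi,
    Matrix.of_apply, Matrix.cons_val', Matrix.cons_val_zero, Matrix.cons_val_one,
    Matrix.cons_val_fin_one]
  push_cast
  rw [← neg_div_neg_eq]
  congr 1 <;> ring

theorem sphFn_moebius_kMat (r : ℝ) (n : ℤ) (α : ℝ) {z : ℂ} (hz : 0 < z.im) :
    sphFn r n (moebius (kMat α) z) = exp (2 * n * α * I) * sphFn r n z := by
  set h : ℝ → ℂ := fun θ => phir r (moebius (kMat (-θ)) z) * exp (2 * n * θ * I) with hh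
  have hper : Function.Periodic h Real.pi := by
    intro θ
    have he : exp (2 * n * (θ + Real.pi : ℝ) * I) = exp (2 * n * θ * I) := by
      rw [← exp_periodic.int_mul n (2 * n * θ * I)]
      push_cast
      ring_nf
    simp only [hh, moebius_kMat_neg_add_pi, he]
  have hshift : ∀ θ : ℝ, phir r (moebius (kMat (-θ)) (moebius (kMat α) z)) * exp (2 * n * θ * I)
      = exp (2 * n * α * I) * h (θ - α) := by
    intro θ
    have he : exp (2 * n * θ * I) = exp (2 * n * α * I) * exp (2 * n * (θ - α : ℝ) * I) := by
      rw [← exp_add]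
      push_cast
      ring_nf
    rw [moebius_kMat_neg_moebius_kMat hz, he]
    simp only [hh]
    ring
  have hint : ∫ θ in (0 - α)..(Real.pi - α), h θ = ∫ θ in (0 : ℝ)..Real.pi, h θ := by
    have := hper.intervalIntegral_add_eq (0 - α) 0
    rwa [zero_add, show 0 - α + Real.pi = Real.pi - α by ring] at this
  simp only [sphFn, hshift, intervalIntegral.integral_const_mul]
  rw [intervalIntegral.integral_comp_sub_right h α, hint]
  ring

/-- The integrand of `sphFn`, in a form that is visibly smooth on the upper half-plane. -/
def sphKernel (r : ℝ) (n : ℤ) (z : ℂ) (θ : ℝ) : ℂ :=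
  exp ((r * I + 1 / 2) * (Real.log z.im - Real.log (kDenom z θ) : ℝ)) * exp (2 * n * θ * I)

theorem sphFn_eq_integral_sphKernel (r : ℝ) (n : ℤ) {z : ℂ} (hz : 0 < z.im) :
    sphFn r n z = (1 / Real.pi : ℂ) * ∫ θ in (0 : ℝ)..Real.pi, sphKernel r n z θ := by
  have hD := fun θ => kDenom_pos hz θ
  simp only [sphFn, sphKernel, phir, im_moebius_kMat_neg]
  congr! 5 with θ
  rw [← ofReal_log (div_pos hz (hD θ)).le, Real.log_div hz.ne' (hD θ).ne']

theorem contDiffOn_sphKernel (r : ℝ) (n : ℤ) :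
    ContDiffOn ℝ (⊤ : ℕ∞) (fun p : ℂ × ℝ => sphKernel r n p.1 p.2)
      ({z : ℂ | 0 < z.im} ×ˢ Set.univ) := by
  have hre : ContDiff ℝ (⊤ : ℕ∞) (fun p : ℂ × ℝ => p.1.re) := reCLM.contDiff.comp contDiff_fst
  have him : ContDiff ℝ (⊤ : ℕ∞) (fun p : ℂ × ℝ => p.1.im) := imCLM.contDiff.comp contDiff_fst
  have hsin : ContDiff ℝ (⊤ : ℕ∞) (fun p : ℂ × ℝ => Real.sin p.2) :=
    Real.contDiff_sin.comp contDiff_snd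
  have hcos : ContDiff ℝ (⊤ : ℕ∞) (fun p : ℂ × ℝ => Real.cos p.2) :=
    Real.contDiff_cos.comp contDiff_snd
  have hD : ContDiff ℝ (⊤ : ℕ∞) (fun p : ℂ × ℝ => kDenom p.1 p.2) :=
    (((hre.mul hsin).add hcos).pow 2).add ((him.mul hsin).pow 2)
  have hlog : ContDiffOn ℝ (⊤ : ℕ∞) (fun p : ℂ × ℝ => Real.log p.1.im - Real.log (kDenom p.1 p.2))
      ({z : ℂ | 0 < z.im} ×ˢ Set.univ) :=
    (him.contDiffOn.log fun p hp => ne_of_gt hp.1).sub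
      (hD.contDiffOn.log fun p hp => (kDenom_pos hp.1 p.2).ne')
  have hθ : ContDiff ℝ (⊤ : ℕ∞) (fun p : ℂ × ℝ => (p.2 : ℂ)) := ofRealCLM.contDiff.comp contDiff_snd
  exact (contDiffOn_const.mul (ofRealCLM.contDiff.comp_contDiffOn hlog)).cexp.mul
    (((contDiff_const.mul hθ).mul contDiff_const).cexp).contDiffOn

theorem contDiffOn_sphFn (r : ℝ) (n : ℤ) :
    ContDiffOn ℝ (⊤ : ℕ∞) (sphFn r n) {z : ℂ | 0 < z.im} := by
  have hU : IsOpen {z : ℂ | 0 < z.im} := isOpen_lt continuous_const continuous_im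
  refine ContDiffOn.congr (contDiffOn_const.mul ?_) fun z hz => sphFn_eq_integral_sphKernel r n hz
  exact contDiffOn_infty.2 fun m =>
    ContDiffOn.intervalIntegral_nat hU 0 Real.pi m (contDiffOn_sphKernel r n)

theorem deriv_deriv_cexp_mul {u u' : ℝ → ℝ} {u'' x : ℝ} {U : Set ℝ} (hU : IsOpen U) (hx : x ∈ U)
    (hu : ∀ t ∈ U, HasDerivAt u (u' t) t) (hu' : HasDerivAt u' u'' x) (s c : ℂ) :
    deriv (fun t' : ℝ => deriv (fun t : ℝ => exp (s * (u t : ℝ)) * c) t') x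
      = (s * u'' + s ^ 2 * (u' x : ℂ) ^ 2) * (exp (s * u x) * c) := by
  have h1 : ∀ t ∈ U, HasDerivAt (fun t : ℝ => exp (s * (u t : ℝ))) (exp (s * u t) * (s * u' t)) t :=
    fun t ht => ((hu t ht).ofReal_comp.const_mul s).cexp
  have h2 : (fun t' : ℝ => deriv (fun t : ℝ => exp (s * (u t : ℝ)) * c) t')
      =ᶠ[nhds x] fun t => exp (s * u t) * (s * u' t) * c := by
    filter_upwards [hU.mem_nhds hx] with t ht using ((h1 t ht).mul_const c).deriv
  rw [h2.deriv_eq]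
  refine (((h1 x hx).fun_mul (hu'.ofReal_comp.const_mul s)).mul_const c).deriv.trans ?_
  ring

theorem laplacian_sphKernel (r : ℝ) (n : ℤ) (θ x : ℝ) {y : ℝ} (hy : 0 < y) :
    (y : ℂ) ^ 2 *
        (deriv (fun x' : ℝ => deriv (fun x'' : ℝ => sphKernel r n (x'' + y * I) θ) x') x
          + deriv (fun y' : ℝ => deriv (fun y'' : ℝ => sphKernel r n (x + y'' * I) θ) y') y)
      = -((1 : ℂ) / 4 + (r : ℂ) ^ 2) * sphKernel r n (x + y * I) θ := by
  set S := Real.sin θ with hS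
  set C := Real.cos θ with hC
  set D : ℝ → ℝ → ℝ := fun x y => (x * S + C) ^ 2 + (y * S) ^ 2 with hDdef
  have hD : ∀ x y : ℝ, 0 < y → 0 < D x y := by
    intro x y hy
    simpa [kDenom] using kDenom_pos (z := x + y * I) (by simpa using hy) θ
  have hK : ∀ x y : ℝ, sphKernel r n (x + y * I) θ
      = exp ((r * I + 1 / 2) * (Real.log y - Real.log (D x y) : ℝ)) * exp (2 * n * θ * I) := by
    intro x y
    simp [sphKernel, kDenom, hDdef, hS, hC]
  have hDx : ∀ t : ℝ, HasDerivAt (fun x => D x y) (2 * S * (t * S + C)) t := by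
    intro t
    have := (((((hasDerivAt_id t).mul_const S).add_const C).pow 2).add_const ((y * S) ^ 2))
    refine this.congr_deriv ?_
    simp
    ring
  have hDy : ∀ t : ℝ, HasDerivAt (fun y => D x y) (2 * S ^ 2 * t) t := by
    intro t
    have := ((((hasDerivAt_id t).mul_const S).pow 2).const_add ((x * S + C) ^ 2))
    refine this.congr_deriv ?_
    simp
    ring
  have hux : ∀ t ∈ (Set.univ : Set ℝ), HasDerivAt (fun x => Real.log y - Real.log (D x y))
      (-(2 * S * (t * S + C) / D t y)) t := fun t _ =>
    ((hDx t).log (hD t y hy).ne').const_sub (Real.log y)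
  have huxx : HasDerivAt (fun t => -(2 * S * (t * S + C) / D t y))
      (-((2 * S * S * D x y - 2 * S * (x * S + C) * (2 * S * (x * S + C))) / D x y ^ 2)) x := by
    have := ((((hasDerivAt_id x).mul_const S).add_const C).const_mul (2 * S)).div (hDx x)
      (hD x y hy).ne'
    refine this.neg.congr_deriv ?_
    simp
  have huy : ∀ t ∈ Set.Ioi (0 : ℝ), HasDerivAt (fun y => Real.log y - Real.log (D x y))
      (t⁻¹ - 2 * S ^ 2 * t / D x t) t := fun t ht =>
    (Real.hasDerivAt_log (ne_of_gt ht)).sub ((hDy t).log (hD x t ht).ne')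
  have huyy : HasDerivAt (fun t => t⁻¹ - 2 * S ^ 2 * t / D x t)
      (-(y ^ 2)⁻¹ - (2 * S ^ 2 * D x y - 2 * S ^ 2 * y * (2 * S ^ 2 * y)) / D x y ^ 2) y := by
    have := ((hasDerivAt_id y).const_mul (2 * S ^ 2)).div (hDy y) (hD x y hy).ne'
    refine ((hasDerivAt_inv hy.ne').sub this).congr_deriv ?_
    simp
  simp only [hK]
  rw [deriv_deriv_cexp_mul isOpen_univ (Set.mem_univ x) hux huxx,
    deriv_deriv_cexp_mul isOpen_Ioi (Set.mem_Ioi.2 hy) huy huyy]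
  have hDxy := (hD x y hy).ne'
  have hlap : y ^ 2 *
      (-((2 * S * S * D x y - 2 * S * (x * S + C) * (2 * S * (x * S + C))) / D x y ^ 2)
      + (-(y ^ 2)⁻¹ - (2 * S ^ 2 * D x y - 2 * S ^ 2 * y * (2 * S ^ 2 * y)) / D x y ^ 2)) = -1 := by
    have hy' := hy.ne'
    field_simp
    simp only [hDdef]
    ring
  have hgrad : y ^ 2 * ((-(2 * S * (x * S + C) / D x y)) ^ 2
      + (y⁻¹ - 2 * S ^ 2 * y / D x y) ^ 2) = 1 := by
    have hy' := hy.ne'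
    field_simp
    simp only [hDdef]
    ring
  generalize -((2 * S * S * D x y - 2 * S * (x * S + C) * (2 * S * (x * S + C))) / D x y ^ 2) = a
    at hlap ⊢
  generalize -(y ^ 2)⁻¹ - (2 * S ^ 2 * D x y - 2 * S ^ 2 * y * (2 * S ^ 2 * y)) / D x y ^ 2 = b
    at hlap ⊢
  generalize -(2 * S * (x * S + C) / D x y) = p at hgrad ⊢
  generalize y⁻¹ - 2 * S ^ 2 * y / D x y = q at hgrad ⊢
  generalize exp ((r * I + 1 / 2) * (Real.log y - Real.log (D x y) : ℝ)) * exp (2 * n * θ * I) = F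
  have hlap' : (y : ℂ) ^ 2 * (a + b) = -1 := by exact_mod_cast hlap
  have hgrad' : (y : ℂ) ^ 2 * ((p : ℂ) ^ 2 + (q : ℂ) ^ 2) = 1 := by exact_mod_cast hgrad
  linear_combination (r * I + 1 / 2) * F * hlap' + (r * I + 1 / 2) ^ 2 * F * hgrad'
    + r ^ 2 * F * I_sq

theorem laplacian_sphFn (r : ℝ) (n : ℤ) (x : ℝ) {y : ℝ} (hy : 0 < y) :
    (y : ℂ) ^ 2 *
        (deriv (fun x' : ℝ => deriv (fun x'' : ℝ => sphFn r n (x'' + y * I)) x') x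
          + deriv (fun y' : ℝ => deriv (fun y'' : ℝ => sphFn r n (x + y'' * I)) y') y)
      = -((1 : ℂ) / 4 + (r : ℂ) ^ 2) * sphFn r n (x + y * I) := by
  have hfx : ContDiffOn ℝ (⊤ : ℕ∞) (fun p : ℝ × ℝ => sphKernel r n (p.1 + y * I) p.2)
      (Set.univ ×ˢ Set.univ) := by
    refine (contDiffOn_sphKernel r n).comp (f := fun p : ℝ × ℝ => ((p.1 + y * I : ℂ), p.2))
      (ContDiff.contDiffOn ?_) fun p _ => ⟨by simpa using hy, Set.mem_univ _⟩
    exact ((ofRealCLM.contDiff.comp contDiff_fst).add contDiff_const).prodMk contDiff_snd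
  have hfy : ContDiffOn ℝ (⊤ : ℕ∞) (fun p : ℝ × ℝ => sphKernel r n (x + p.1 * I) p.2)
      (Set.Ioi 0 ×ˢ Set.univ) := by
    refine (contDiffOn_sphKernel r n).comp (f := fun p : ℝ × ℝ => ((x + p.1 * I : ℂ), p.2))
      (ContDiff.contDiffOn ?_) fun p hp => ⟨by simpa using hp.1, Set.mem_univ _⟩
    exact (contDiff_const.add
      ((ofRealCLM.contDiff.comp contDiff_fst).mul contDiff_const)).prodMk contDiff_snd
  have hx1 : (fun x' : ℝ => sphFn r n (x' + y * I)) = fun x' : ℝ =>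
      (1 / Real.pi : ℂ) * ∫ θ in (0 : ℝ)..Real.pi, sphKernel r n (x' + y * I) θ :=
    funext fun x' => sphFn_eq_integral_sphKernel r n (by simpa using hy)
  have hy1 : ∀ t : ℝ, 0 < t → (fun y' : ℝ => sphFn r n (x + y' * I)) =ᶠ[nhds t] fun y' : ℝ =>
      (1 / Real.pi : ℂ) * ∫ θ in (0 : ℝ)..Real.pi, sphKernel r n (x + y' * I) θ := by
    intro t ht
    filter_upwards [Ioi_mem_nhds ht] with y' hy'
    exact sphFn_eq_integral_sphKernel r n (by simpa using hy')
  have hy2 : (fun y' : ℝ => deriv (fun y'' : ℝ => sphFn r n (x + y'' * I)) y') =ᶠ[nhds y]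
      fun y' : ℝ => (1 / Real.pi : ℂ) * deriv (fun y'' : ℝ =>
        ∫ θ in (0 : ℝ)..Real.pi, sphKernel r n (x + y'' * I) θ) y' := by
    filter_upwards [Ioi_mem_nhds hy] with y' hy'
    rw [(hy1 y' hy').deriv_eq, deriv_const_mul_field]
  rw [hx1, hy2.deriv_eq, sphFn_eq_integral_sphKernel r n (by simpa using hy)]
  simp only [deriv_const_mul_field]
  rw [hfx.deriv_deriv_intervalIntegral (f := fun t θ => sphKernel r n (t + y * I) θ)
      isOpen_univ 0 Real.pi (Set.mem_univ x),
    hfy.deriv_deriv_intervalIntegral (f := fun t θ => sphKernel r n (x + t * I) θ)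
      isOpen_Ioi 0 Real.pi (Set.mem_Ioi.2 hy)]
  have hix := (((hfx.deriv_partial_fst isOpen_univ (f := fun t θ => sphKernel r n (t + y * I) θ)
    ).deriv_partial_fst isOpen_univ
      (f := fun s θ => deriv (fun t : ℝ => sphKernel r n (t + y * I) θ) s)).continuous_right
      (f := fun s' θ => deriv (fun s => deriv (fun t : ℝ => sphKernel r n (t + y * I) θ) s) s')
      (Set.mem_univ x)).intervalIntegrable (μ := MeasureTheory.volume) 0 Real.pi
  have hiy := (((hfy.deriv_partial_fst isOpen_Ioi (f := fun t θ => sphKernel r n (x + t * I) θ)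
    ).deriv_partial_fst isOpen_Ioi
      (f := fun s θ => deriv (fun t : ℝ => sphKernel r n (x + t * I) θ) s)).continuous_right
      (f := fun s' θ => deriv (fun s => deriv (fun t : ℝ => sphKernel r n (x + t * I) θ) s) s')
      (Set.mem_Ioi.2 hy)).intervalIntegrable (μ := MeasureTheory.volume) 0 Real.pi
  rw [← mul_add, ← intervalIntegral.integral_add hix hiy, mul_left_comm,
    ← intervalIntegral.integral_const_mul]
  simp only [laplacian_sphKernel r n _ x hy, intervalIntegral.integral_const_mul]
  ring

/-- The generalized spherical function `Φ_{r,n}` satisfies: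
(a) `Φ_{r,n}(k_α·z) = e^{2inα}·Φ_{r,n}(z)` on ℍ;
(b) it is smooth on ℍ and is an eigenfunction of the hyperbolic Laplacian
`y²(∂²/∂x² + ∂²/∂y²)` with eigenvalue `−(1/4 + r²)`. -/
theorem sphFn_equivariance_and_eigenfunction (r : ℝ) (n : ℤ) :
    (∀ α : ℝ, ∀ z : ℂ, 0 < z.im →
      sphFn r n (moebius (kMat α) z)
        = Complex.exp (2 * n * α * Complex.I) * sphFn r n z) ∧
    ContDiffOn ℝ (⊤ : ℕ∞) (sphFn r n) {z : ℂ | 0 < z.im} ∧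
    (∀ x y : ℝ, 0 < y →
      (y : ℂ) ^ 2 *
          (deriv (fun x' : ℝ => deriv (fun x'' : ℝ => sphFn r n (x'' + y * Complex.I)) x') x
            + deriv (fun y' : ℝ => deriv (fun y'' : ℝ => sphFn r n (x + y'' * Complex.I)) y') y)
        = -((1 : ℂ) / 4 + (r : ℂ) ^ 2) * sphFn r n (x + y * Complex.I)) := by
  exact ⟨fun α _ hz => sphFn_moebius_kMat r n α hz, contDiffOn_sphFn r n,
    fun x _ hy => laplacian_sphFn r n x hy⟩

end
end
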